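/- arXiv:1212.1925 — 9 statements merged into one kernel-verified Lean document; each statement's English description precedes it below -/
import Mathlib

section
/- Let K be a field and n ≥ 2 an integer. If M ∈ M_n(K) is a matrix with trace 0, then there exist matrices A, B ∈ M_n(K) such that M = AB − BA. -/
open Matrix

section

variable {K : Type*} [Field K]

/-- The nilpotent matrix with ones on the first superdiagonal. -/
def Matrix.upperShift (R : Type*) [Zero R] [One R] (n : ℕ) : Matrix (Fin n) (Fin n) R :=
  of fun i j => if (i : ℕ) + 1 = j then 1 else 0

/-- The sum of the entries of `h` strictly above row `i` on the diagonal through `(i - 1, j)`. -/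
def diagonalPartialSum {R : Type*} [AddCommMonoid R] (h : ℕ → ℕ → R) : ℕ → ℕ → R
  | 0, _ => 0
  | i + 1, 0 => h i 0
  | i + 1, j + 1 => h i (j + 1) + diagonalPartialSum h i j

theorem diagonalPartialSum_add_eq_sum {R : Type*} [AddCommMonoid R] (h : ℕ → ℕ → R) (d j : ℕ) :
    diagonalPartialSum h (j + d + 1) j = ∑ k ∈ Finset.range (j + 1), h (k + d) k := by
  induction j with
  | zero => simp [diagonalPartialSum]
  | succ j ih =>
    rw [Finset.sum_range_succ, ← ih, diagonalPartialSum, add_comm]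
    congr 2
    omega

theorem Matrix.exists_upperShift_commutator {R : Type*} [Ring R] {n : ℕ} (h : ℕ → ℕ → R)
    (hsum : ∀ d ≤ n, ∑ k ∈ Finset.range (n - d + 1), h (k + d) k = 0) :
    ∃ B : Matrix (Fin (n + 1)) (Fin (n + 1)) R,
      (of fun i j : Fin (n + 1) => h i j) = upperShift R (n + 1) * B - B * upperShift R (n + 1) := by
  set b := diagonalPartialSum h
  refine ⟨of fun i j => b i j, ?_⟩
  have hl (i j : Fin (n + 1)) : (upperShift R (n + 1) * of fun i j : Fin (n + 1) => b i j) i j =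
      if (i : ℕ) = n then 0 else b (i + 1) j := by
    rw [mul_apply]
    split_ifs with hi
    · refine Finset.sum_eq_zero fun k _ => ?_
      have : ¬ (i : ℕ) + 1 = k := by omega
      simp [upperShift, this]
    · rw [Finset.sum_eq_single ⟨i + 1, by omega⟩]
      · simp [upperShift]
      · intro k _ hk
        have : ¬ (i : ℕ) + 1 = k := fun e => hk (Fin.ext e.symm)
        simp [upperShift, this]
      · simp
  have hr (i j : Fin (n + 1)) : ((of fun i j : Fin (n + 1) => b i j) * upperShift R (n + 1)) i j =
      if (j : ℕ) = 0 then 0 else b i (j - 1) := by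
    rw [mul_apply]
    split_ifs with hj
    · refine Finset.sum_eq_zero fun k _ => ?_
      have : ¬ (k : ℕ) + 1 = j := by omega
      simp [upperShift, this]
    · rw [Finset.sum_eq_single ⟨j - 1, by omega⟩]
      · have : (j : ℕ) - 1 + 1 = j := by omega
        simp [upperShift, this]
      · intro k _ hk
        have : ¬ (k : ℕ) + 1 = j := fun e => hk (Fin.ext (by simp; omega))
        simp [upperShift, this]
      · simp
  ext ⟨i, hi⟩ ⟨j, hj⟩
  rw [sub_apply, hl, hr]
  simp only [of_apply]
  by_cases hin : i = n
  · subst hin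
    have hs := hsum (i - j) (by omega)
    rw [show i - (i - j) + 1 = j + 1 by omega] at hs
    rw [Finset.sum_range_succ, show j + (i - j) = i by omega] at hs
    obtain _ | j := j
    · simpa using hs
    · have hb := diagonalPartialSum_add_eq_sum h (i - (j + 1)) j
      rw [← hb, show j + (i - (j + 1)) + 1 = i by omega] at hs
      simpa using eq_neg_of_add_eq_zero_right hs
  · obtain _ | j := j <;> simp [hin, b, diagonalPartialSum]

theorem Matrix.exists_upperShift_commutator_of_hessenberg {R : Type*} [Ring R] {n : ℕ}
    (H : Matrix (Fin (n + 1)) (Fin (n + 1)) R)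
    (hH : ∀ i j : Fin (n + 1), (j : ℕ) + 1 < i → H i j = 0)
    (hsub : ∑ i : Fin n, H i.succ i.castSucc = 0) (htr : H.trace = 0) :
    ∃ B, H = upperShift R (n + 1) * B - B * upperShift R (n + 1) := by
  set h : ℕ → ℕ → R := fun i j =>
    if hij : i < n + 1 ∧ j < n + 1 then H ⟨i, hij.1⟩ ⟨j, hij.2⟩ else 0
  have hHh : H = of fun i j : Fin (n + 1) => h i j := by
    ext i j
    simp [h, -Order.lt_add_one_iff]
  obtain ⟨B, hB⟩ := exists_upperShift_commutator (n := n) h fun d hd => by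
    obtain _ | _ | d := d
    · rw [← htr, trace, ← Fin.sum_univ_eq_sum_range (fun k => h (k + 0) k)]
      simp [h, -Order.lt_add_one_iff]
    · rw [show n - (0 + 1) + 1 = n by omega, ← hsub,
        ← Fin.sum_univ_eq_sum_range (fun k => h (k + (0 + 1)) k)]
      refine Finset.sum_congr rfl fun k _ => ?_
      have : (k : ℕ) < n + 1 := by omega
      simp only [h]
      rw [dif_pos ⟨by omega, this⟩]
      rfl
    · refine Finset.sum_eq_zero fun k _ => ?_
      simp only [h]
      split_ifs
      · exact hH _ _ (by simp)
      · rfl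
  exact ⟨B, hHh.trans hB⟩

theorem Matrix.isUnit_one_sub_upperShift {R : Type*} [CommRing R] (n : ℕ) :
    IsUnit (1 - upperShift R n) := by
  rw [isUnit_iff_isUnit_det, det_of_isUpperTriangular]
  · simp [upperShift]
  · intro i j hij
    have h1 : i ≠ j := ne_of_gt hij
    have h2 : ¬ (i : ℕ) + 1 = j := by have : (j : ℕ) < i := hij; omega
    simp [upperShift, h1, h2]

/-- The block matrix with top left entry `a`, first row `r`, first column `c` and remaining
block `D`. -/
def Matrix.finBlocks {R : Type*} {n : ℕ} (a : R) (r c : Fin n → R) (D : Matrix (Fin n) (Fin n) R) :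
    Matrix (Fin (n + 1)) (Fin (n + 1)) R :=
  of (Fin.cons (Fin.cons a r) fun i => Fin.cons (c i) (D i))

namespace Matrix.finBlocks

variable {R : Type*} {n : ℕ} (a : R) (r c : Fin n → R) (D : Matrix (Fin n) (Fin n) R)

@[simp] theorem apply_zero_zero : finBlocks a r c D 0 0 = a := rfl

@[simp] theorem apply_zero_succ (j : Fin n) : finBlocks a r c D 0 j.succ = r j := rfl

@[simp] theorem apply_succ_zero (i : Fin n) : finBlocks a r c D i.succ 0 = c i := rfl

@[simp] theorem apply_succ_succ (i j : Fin n) : finBlocks a r c D i.succ j.succ = D i j := rfl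

theorem eta (M : Matrix (Fin (n + 1)) (Fin (n + 1)) R) :
    finBlocks (M 0 0) (fun j => M 0 j.succ) (fun i => M i.succ 0)
      (M.submatrix Fin.succ Fin.succ) = M := by
  ext i j
  cases i using Fin.cases <;> cases j using Fin.cases <;> rfl

theorem mul [CommSemiring R] (a' : R) (r' c' : Fin n → R) (D' : Matrix (Fin n) (Fin n) R) :
    finBlocks a r c D * finBlocks a' r' c' D' =
      finBlocks (a * a' + r ⬝ᵥ c') (a • r' + r ᵥ* D') (a' • c + D *ᵥ c')
        (vecMulVec c r' + D * D') := by
  ext i j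
  cases i using Fin.cases <;> cases j using Fin.cases <;>
    simp [mul_apply, Fin.sum_univ_succ, dotProduct, vecMul, mulVec, vecMulVec_apply, mul_comm a']

theorem trace [AddCommMonoid R] : (finBlocks a r c D).trace = a + D.trace := by
  simp [Matrix.trace, Fin.sum_univ_succ]

theorem sub [Sub R] (a' : R) (r' c' : Fin n → R) (D' : Matrix (Fin n) (Fin n) R) :
    finBlocks a r c D - finBlocks a' r' c' D' =
      finBlocks (a - a') (r - r') (c - c') (D - D') := by
  ext i j
  cases i using Fin.cases <;> cases j using Fin.cases <;> rfl

theorem one [Zero R] [One R] : finBlocks 1 0 0 (1 : Matrix (Fin n) (Fin n) R) = 1 := by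
  ext i j
  cases i using Fin.cases <;> cases j using Fin.cases <;>
    simp [one_apply, Fin.succ_ne_zero, (Fin.succ_ne_zero _).symm]

theorem mulVec_cons [CommSemiring R] (x : R) (v : Fin n → R) :
    finBlocks a r c D *ᵥ (Fin.cons x v : Fin (n + 1) → R) =
      Fin.cons (a * x + r ⬝ᵥ v) (x • c + D *ᵥ v) := by
  ext i
  cases i using Fin.cases <;>
    simp [mulVec, dotProduct, Fin.sum_univ_succ, mul_comm x]

theorem hessenberg [Zero R] (t : R) (r : Fin (n + 1) → R)
    {H : Matrix (Fin (n + 1)) (Fin (n + 1)) R}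
    (hH : ∀ i j : Fin (n + 1), (j : ℕ) + 1 < i → H i j = 0) (i j : Fin (n + 2))
    (hij : (j : ℕ) + 1 < i) : finBlocks a r (Pi.single 0 t) H i j = 0 := by
  cases i using Fin.cases with
  | zero => simp at hij
  | succ i =>
    cases j using Fin.cases with
    | zero =>
      have hi : i ≠ 0 := by
        rintro rfl
        simp at hij
      simp [hi]
    | succ j => exact hH i j (by simpa using hij)

theorem sum_subdiagonal [AddCommMonoid R] (t : R) (r : Fin (n + 1) → R)
    (H : Matrix (Fin (n + 1)) (Fin (n + 1)) R) :
    ∑ i : Fin (n + 1), finBlocks a r (Pi.single 0 t) H i.succ i.castSucc =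
      t + ∑ i : Fin n, H i.succ i.castSucc := by
  rw [Fin.sum_univ_succ]
  simp only [← Fin.succ_castSucc, apply_succ_succ, Fin.castSucc_zero, apply_succ_zero,
    Pi.single_eq_same]

end Matrix.finBlocks

/-- The embedding of square matrices given by adding a diagonal entry `1` at the top left. -/
def Matrix.oneBlock (R : Type*) [CommSemiring R] (n : ℕ) :
    Matrix (Fin n) (Fin n) R →* Matrix (Fin (n + 1)) (Fin (n + 1)) R where
  toFun D := finBlocks 1 0 0 D
  map_one' := finBlocks.one
  map_mul' D D' := by simp [finBlocks.mul]

theorem Matrix.oneBlock_conj_finBlocks {R : Type*} [CommRing R] {n : ℕ}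
    (P : (Matrix (Fin n) (Fin n) R)ˣ) (a : R) (r c : Fin n → R) (D : Matrix (Fin n) (Fin n) R) :
    (↑(Units.map (oneBlock R n) P)⁻¹ : Matrix (Fin (n + 1)) (Fin (n + 1)) R) * finBlocks a r c D *
        Units.map (oneBlock R n) P =
      finBlocks a (r ᵥ* P.val) (P⁻¹.val *ᵥ c) (P⁻¹.val * D * P.val) := by
  rw [← map_inv]
  simp [oneBlock, finBlocks.mul]

theorem Matrix.exists_units_mulVec_eq_single {n : ℕ} {v : Fin (n + 1) → K} (hv : v ≠ 0) :
    ∃ P : (Matrix (Fin (n + 1)) (Fin (n + 1)) K)ˣ, P⁻¹.val *ᵥ v = Pi.single 0 1 := by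
  obtain ⟨i, hi⟩ := Function.ne_iff.mp hv
  have hu : IsUnit (((1 : Matrix (Fin (n + 1)) (Fin (n + 1)) K).updateCol i v).submatrix id
      (Equiv.swap 0 i)) := by
    rw [isUnit_iff_isUnit_det, det_permute', ← cramer_apply, cramer_one]
    exact (Units.isUnit _).map (Int.castRingHom K) |>.mul (isUnit_iff_ne_zero.mpr hi)
  obtain ⟨P, hP⟩ := hu
  have hPv : P.val *ᵥ Pi.single 0 1 = v := by
    rw [hP]
    ext j
    simp
  refine ⟨P, ?_⟩
  rw [← hPv, mulVec_mulVec, Units.inv_mul, one_mulVec]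

theorem Matrix.exists_units_mulVec_eq_single_zero_or_one {n : ℕ} (v : Fin (n + 1) → K) :
    ∃ (P : (Matrix (Fin (n + 1)) (Fin (n + 1)) K)ˣ) (t : K),
      P⁻¹.val *ᵥ v = Pi.single 0 t ∧ (t = 0 ∨ t = 1) := by
  by_cases hv : v = 0
  · exact ⟨1, 0, by simp [hv], .inl rfl⟩
  · obtain ⟨P, hP⟩ := exists_units_mulVec_eq_single hv
    exact ⟨P, 1, hP, .inr rfl⟩

/-- The entry `t` and the sum of the subdiagonal of the conjugate are linked so that bordering
the conjugate on the left by the column `(t, 0, …, 0)` gives a subdiagonal sum of `0` or `1`. -/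
theorem Matrix.exists_hessenberg_conj {n : ℕ} (M : Matrix (Fin (n + 1)) (Fin (n + 1)) K)
    (c : Fin (n + 1) → K) :
    ∃ (P : (Matrix (Fin (n + 1)) (Fin (n + 1)) K)ˣ) (t : K)
      (H : Matrix (Fin (n + 1)) (Fin (n + 1)) K),
      P⁻¹.val *ᵥ c = Pi.single 0 t ∧ P⁻¹.val * M * P.val = H ∧
      (∀ i j : Fin (n + 1), (j : ℕ) + 1 < i → H i j = 0) ∧
      (∑ i : Fin n, H i.succ i.castSucc = 0 ∧ (t = 0 ∨ t = 1) ∨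
        ∑ i : Fin n, H i.succ i.castSucc = 1 ∧ (t = 0 ∨ t = -1)) := by
  induction n with
  | zero =>
    obtain ⟨P, t, hP, ht⟩ := exists_units_mulVec_eq_single_zero_or_one c
    exact ⟨P, t, _, hP, rfl, fun i j => by omega, .inl ⟨by simp, ht⟩⟩
  | succ n ih =>
    obtain ⟨P₀, t₀, hP₀, ht₀⟩ := exists_units_mulVec_eq_single_zero_or_one c
    -- It suffices to conjugate so that the subdiagonal sum is `0` or `1`: `-P` fixes the sign.
    suffices ∃ (P : (Matrix (Fin (n + 2)) (Fin (n + 2)) K)ˣ)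
        (H : Matrix (Fin (n + 2)) (Fin (n + 2)) K),
        P⁻¹.val *ᵥ c = Pi.single 0 t₀ ∧ P⁻¹.val * M * P.val = H ∧
        (∀ i j : Fin (n + 2), (j : ℕ) + 1 < i → H i j = 0) ∧
        (∑ i : Fin (n + 1), H i.succ i.castSucc = 0 ∨ ∑ i : Fin (n + 1), H i.succ i.castSucc = 1) by
      obtain ⟨P, H, hPc, hPM, hH, hs | hs⟩ := this
      · exact ⟨P, t₀, H, hPc, hPM, hH, .inl ⟨hs, ht₀⟩⟩
      · refine ⟨-P, -t₀, H, ?_, ?_, hH, .inr ⟨hs, by simpa [neg_inj] using ht₀⟩⟩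
        · rw [← neg_inv, Units.val_neg, neg_mulVec, hPc, Pi.single_neg]
        · rw [← neg_inv, Units.val_neg, Units.val_neg, neg_mul, neg_mul_neg, hPM]
    set N := P₀⁻¹.val * M * P₀.val with hN
    obtain ⟨P₁, t₁, H₁, hP₁, hPH₁, hH₁, hs₁⟩ :=
      ih (N.submatrix Fin.succ Fin.succ) fun i => N i.succ 0
    set Q := Units.map (oneBlock K (n + 1)) P₁ with hQ
    refine ⟨P₀ * Q, finBlocks (N 0 0) ((fun j => N 0 j.succ) ᵥ* P₁.val) (Pi.single 0 t₁) H₁,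
      ?_, ?_, ?_, ?_⟩
    · have hcons : (Pi.single 0 t₀ : Fin (n + 2) → K) = Fin.cons t₀ 0 := by
        ext i
        cases i using Fin.cases <;> simp
      rw [_root_.mul_inv_rev, Units.val_mul, ← mulVec_mulVec, hP₀, hcons, hQ, ← map_inv]
      simp [oneBlock, finBlocks.mulVec_cons]
    · calc (P₀ * Q)⁻¹.val * M * (P₀ * Q).val = Q⁻¹.val * N * Q.val := by
            simp only [hN, _root_.mul_inv_rev, Units.val_mul, mul_assoc]
        _ = _ := by rw [← finBlocks.eta N, hQ, oneBlock_conj_finBlocks, hP₁, hPH₁]; rfl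
    · exact finBlocks.hessenberg _ _ _ hH₁
    · rw [finBlocks.sum_subdiagonal]
      rcases hs₁ with ⟨hs, rfl | rfl⟩ | ⟨hs, rfl | rfl⟩ <;> simp [hs]

theorem Matrix.exists_commutator_of_conj {R m : Type*} [Ring R] [Fintype m] [DecidableEq m]
    {M : Matrix m m R} (P : (Matrix m m R)ˣ)
    (h : ∃ A B, P⁻¹.val * M * P.val = A * B - B * A) : ∃ A B, M = A * B - B * A := by
  obtain ⟨A, B, h⟩ := h
  refine ⟨P.val * A * P⁻¹.val, P.val * B * P⁻¹.val, ?_⟩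
  calc M = P.val * (P⁻¹.val * M * P.val) * P⁻¹.val := by simp [mul_assoc]
    _ = _ := by rw [h]; simp [mul_assoc, mul_sub, sub_mul]

theorem Matrix.finBlocks.exists_commutator {R : Type*} [CommRing R] {n : ℕ} (r c : Fin n → R)
    {A B : Matrix (Fin n) (Fin n) R} (hA : IsUnit (1 - A)) :
    ∃ A' B', finBlocks 0 r c (A * B - B * A) = A' * B' - B' * A' := by
  obtain ⟨U, hU⟩ := hA
  refine ⟨finBlocks 1 0 0 A, finBlocks 0 (r ᵥ* U⁻¹.val) (-(U⁻¹.val *ᵥ c)) B, ?_⟩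
  have hr : r ᵥ* U⁻¹.val - (r ᵥ* U⁻¹.val) ᵥ* A = r := by
    rw [← vecMul_one (r ᵥ* U⁻¹.val), vecMul_vecMul _ 1 A, ← vecMul_sub, one_mul, ← hU,
      vecMul_vecMul, Units.inv_mul, vecMul_one]
  have hc : U⁻¹.val *ᵥ c - A *ᵥ (U⁻¹.val *ᵥ c) = c := by
    rw [← one_mulVec (U⁻¹.val *ᵥ c), mulVec_mulVec _ A 1, ← sub_mulVec, mul_one, ← hU,
      mulVec_mulVec, Units.mul_inv, one_mulVec]
  generalize r ᵥ* U⁻¹.val = b at *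
  generalize U⁻¹.val *ᵥ c = d at *
  simp only [finBlocks.mul, finBlocks.sub]
  congr 1 <;> simp [mulVec_neg, hr, hc, neg_add_eq_sub]

theorem Matrix.exists_conj_eq_finBlocks {n : ℕ} {M : Matrix (Fin (n + 1)) (Fin (n + 1)) K}
    (hM : ¬ M.IsDiag) :
    ∃ (P : (Matrix (Fin (n + 1)) (Fin (n + 1)) K)ˣ) (r c : Fin n → K)
      (D : Matrix (Fin n) (Fin n) K), c ≠ 0 ∧ P⁻¹.val * M * P.val = finBlocks 0 r c D := by
  obtain ⟨i, j, hij, hMij⟩ : ∃ i j, i ≠ j ∧ M i j ≠ 0 := by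
    simpa [IsDiag, Pairwise] using hM
  obtain ⟨P, hP⟩ := exists_units_mulVec_eq_single (v := Pi.single j (1 : K)) (by simp)
  set N := P⁻¹.val * M * P.val with hN
  set c : Fin n → K := fun k => N k.succ 0 with hc
  have hc0 : c ≠ 0 := by
    intro h
    have hcol : N *ᵥ Pi.single 0 1 = N 0 0 • Pi.single 0 1 := by
      ext k
      cases k using Fin.cases with
      | zero => simp
      | succ k => simpa [hc] using congrFun h k
    have hMcol : M *ᵥ Pi.single j 1 = N 0 0 • Pi.single j 1 := by
      have := congrArg (P.val *ᵥ ·) hcol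
      simp only [← hP, mulVec_smul, mulVec_mulVec] at this
      simpa only [hN, mul_assoc, Units.mul_inv, Units.mul_inv_cancel_left, one_mulVec, mul_one]
        using this
    exact hMij (by simpa [hij] using congrFun hMcol i)
  obtain ⟨k, hk⟩ := Function.ne_iff.mp hc0
  set y : Fin n → K := Pi.single k (-N 0 0 / c k)
  have hy : y ⬝ᵥ c = -N 0 0 := by simp [y, div_mul_cancel₀ _ hk]
  let Q : (Matrix (Fin (n + 1)) (Fin (n + 1)) K)ˣ :=
    ⟨finBlocks 1 (-y) 0 1, finBlocks 1 y 0 1, by simp [finBlocks.mul, finBlocks.one],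
      by simp [finBlocks.mul, finBlocks.one]⟩
  have hQ : Q⁻¹.val * N * Q.val = finBlocks 1 y 0 1 * N * finBlocks 1 (-y) 0 1 := rfl
  set r : Fin n → K := fun k => N 0 k.succ
  set D := N.submatrix Fin.succ Fin.succ
  refine ⟨P * Q, r + y ᵥ* D, c, vecMulVec c (-y) + D, hc0, ?_⟩
  calc (P * Q)⁻¹.val * M * (P * Q).val = Q⁻¹.val * N * Q.val := by
        simp only [hN, _root_.mul_inv_rev, Units.val_mul, mul_assoc]
    _ = finBlocks 1 y 0 1 * finBlocks (N 0 0) r c D * finBlocks 1 (-y) 0 1 := by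
        rw [hQ, finBlocks.eta N]
    _ = _ := by simp [finBlocks.mul, hy]

end

theorem shoda_albert_muckenhoupt (K : Type*) [Field K] (n : ℕ) (hn : 2 ≤ n)
    (M : Matrix (Fin n) (Fin n) K) (hM : Matrix.trace M = 0) :
    ∃ A B : Matrix (Fin n) (Fin n) K, M = A * B - B * A := by
  obtain ⟨n, rfl⟩ : ∃ m, n = m + 2 := ⟨n - 2, by omega⟩
  by_cases hdiag : M.IsDiag
  · obtain ⟨B, hB⟩ := M.exists_upperShift_commutator_of_hessenberg
      (fun i j hij => hdiag (by rintro rfl; omega))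
      (Finset.sum_eq_zero fun i _ => hdiag i.castSucc_lt_succ.ne') hM
    exact ⟨_, B, hB⟩
  obtain ⟨P, r, c, D, hc, hP⟩ := exists_conj_eq_finBlocks hdiag
  refine exists_commutator_of_conj P ?_
  have htr : D.trace = 0 := by
    rw [← zero_add D.trace, ← finBlocks.trace 0 r c D, ← hP, mul_assoc, trace_mul_comm]
    simpa [mul_assoc] using hM
  obtain ⟨Q, t, H, hQc, hQD, hH, hs⟩ := exists_hessenberg_conj D c
  rw [hP]
  refine exists_commutator_of_conj (Units.map (oneBlock K (n + 1)) Q) ?_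
  rw [oneBlock_conj_finBlocks, hQc, hQD]
  have htrH : H.trace = 0 := by
    rw [← hQD, mul_assoc, trace_mul_comm]
    simpa [mul_assoc] using htr
  obtain ⟨hs, -⟩ | ⟨hs, ht⟩ := hs
  · obtain ⟨B, hB⟩ := H.exists_upperShift_commutator_of_hessenberg hH hs htrH
    rw [hB]
    exact finBlocks.exists_commutator _ _ (isUnit_one_sub_upperShift _)
  · have ht0 : t ≠ 0 := by
      rintro rfl
      refine hc ?_
      rw [← one_mulVec c, ← Q.mul_inv, ← mulVec_mulVec, hQc, Pi.single_zero, mulVec_zero]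
    obtain ⟨B, hB⟩ := exists_upperShift_commutator_of_hessenberg
      (finBlocks 0 (r ᵥ* Q.val) (Pi.single 0 t) H) (finBlocks.hessenberg _ _ _ hH)
      (by rw [finBlocks.sum_subdiagonal, hs, ht.resolve_left ht0, neg_add_cancel])
      (by rw [finBlocks.trace, htrH, zero_add])
    exact ⟨_, B, hB⟩
end

section
/- Let K be a field and n ≥ 2 an integer. Then the set {AB − BA | A, B ∈ M_n(K)} is exactly equal to the set of matrices in M_n(K) with trace 0. -/
open Matrix

section

variable {K : Type*}

/-- The square matrix with corner entry `a`, remaining first row `r`, remaining first column `c`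
and lower right block `M`. -/
def bordered {m : ℕ} (a : K) (r c : Fin m → K) (M : Matrix (Fin m) (Fin m) K) :
    Matrix (Fin (m + 1)) (Fin (m + 1)) K :=
  of (Fin.cons (Fin.cons a r) fun i => Fin.cons (c i) (M i))

section bordered

variable {m : ℕ} (a b : K) (r s c d : Fin m → K) (M N : Matrix (Fin m) (Fin m) K)

@[simp] theorem bordered_zero_zero : bordered a r c M 0 0 = a := rfl

@[simp] theorem bordered_zero_succ (j : Fin m) : bordered a r c M 0 j.succ = r j := rfl

@[simp] theorem bordered_succ_zero (i : Fin m) : bordered a r c M i.succ 0 = c i := rfl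

@[simp] theorem bordered_succ_succ (i j : Fin m) : bordered a r c M i.succ j.succ = M i j := rfl

theorem eq_bordered (A : Matrix (Fin (m + 1)) (Fin (m + 1)) K) :
    A = bordered (A 0 0) (fun j => A 0 j.succ) (fun i => A i.succ 0)
      (A.submatrix Fin.succ Fin.succ) := by
  ext i j
  refine Fin.cases ?_ (fun i => ?_) i <;> refine Fin.cases ?_ (fun j => ?_) j <;> simp

variable [Field K]

theorem bordered_mul : bordered a r c M * bordered b s d N =
    bordered (a * b + r ⬝ᵥ d) (a • s + r ᵥ* N) (b • c + M *ᵥ d) (vecMulVec c s + M * N) := by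
  ext i j
  refine Fin.cases ?_ (fun i => ?_) i <;> refine Fin.cases ?_ (fun j => ?_) j <;>
    simp [mul_apply, Fin.sum_univ_succ, dotProduct, vecMul, mulVec, vecMulVec_apply, mul_comm]

theorem bordered_sub : bordered a r c M - bordered b s d N =
    bordered (a - b) (r - s) (c - d) (M - N) := by
  ext i j
  refine Fin.cases ?_ (fun i => ?_) i <;> refine Fin.cases ?_ (fun j => ?_) j <;> simp

theorem bordered_one : bordered 1 0 0 (1 : Matrix (Fin m) (Fin m) K) = 1 := by
  ext i j
  refine Fin.cases ?_ (fun i => ?_) i <;> refine Fin.cases ?_ (fun j => ?_) j <;>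
    simp [one_apply, Fin.succ_ne_zero, (Fin.succ_ne_zero _).symm]

theorem trace_bordered : (bordered a r c M).trace = a + M.trace := by
  simp [trace, Fin.sum_univ_succ]

end bordered

variable [Field K]

/-- `A` is an additive commutator of matrices. -/
def IsCommutator {m : ℕ} (A : Matrix (Fin m) (Fin m) K) : Prop :=
  ∃ X Y : Matrix (Fin m) (Fin m) K, A = X * Y - Y * X

theorem IsCommutator.of_conj {m : ℕ} {A P Q : Matrix (Fin m) (Fin m) K} (hPQ : P * Q = 1)
    (h : IsCommutator (Q * A * P)) : IsCommutator A := by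
  have hQP : Q * P = 1 := mul_eq_one_comm.mp hPQ
  obtain ⟨X, Y, h⟩ := h
  refine ⟨P * X * Q, P * Y * Q, ?_⟩
  calc A = (P * Q) * A * (P * Q) := by simp [hPQ]
    _ = P * (Q * A * P) * Q := by simp only [mul_assoc]
    _ = P * (X * Y - Y * X) * Q := by rw [h]
    _ = P * X * (Q * P) * Y * Q - P * Y * (Q * P) * X * Q := by
      rw [hQP]
      simp only [mul_one, mul_sub, sub_mul, mul_assoc]
    _ = _ := by simp only [mul_assoc]

/-- The nilpotent matrix with ones just above the diagonal. -/
def superdiagonal (K : Type*) [Field K] (m : ℕ) : Matrix (Fin m) (Fin m) K :=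
  of fun i j => if (j : ℕ) = i + 1 then 1 else 0

/-- Upper Hessenberg matrices: all entries below the subdiagonal vanish. -/
def IsHessenberg {m : ℕ} (A : Matrix (Fin m) (Fin m) K) : Prop :=
  ∀ i j : Fin m, (j : ℕ) + 1 < i → A i j = 0

theorem superdiagonal_succ (m : ℕ) : superdiagonal K (m + 1) =
    bordered 0 (fun j => if (j : ℕ) = 0 then 1 else 0) 0 (superdiagonal K m) := by
  ext i j
  refine Fin.cases ?_ (fun i => ?_) i <;> refine Fin.cases ?_ (fun j => ?_) j <;>
    simp [superdiagonal]

theorem isUnit_one_sub_superdiagonal (m : ℕ) : IsUnit (1 - superdiagonal K m) := by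
  rw [isUnit_iff_isUnit_det, det_of_isUpperTriangular]
  · simp [superdiagonal]
  · intro i j hij
    have hij' : (j : ℕ) < i := hij
    have h1 : i ≠ j := by omega
    have h2 : (j : ℕ) ≠ i + 1 := by omega
    simp [superdiagonal, h1, h2]

/-- The entries of the solution `Y` of `N * Y - Y * N = H`, where `N` is the superdiagonal matrix
and `h` lists the entries of `H`. -/
def shiftSolution (h : ℕ → ℕ → K) : ℕ → ℕ → K
  | 0, _ => 0
  | i + 1, 0 => h i 0
  | i + 1, j + 1 => h i (j + 1) + shiftSolution h i j

theorem shiftSolution_diag (h : ℕ → ℕ → K) (i : ℕ) :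
    shiftSolution h (i + 1) i = ∑ k ∈ Finset.range (i + 1), h k k := by
  induction i with
  | zero => simp [shiftSolution]
  | succ i ih => rw [shiftSolution, ih, Finset.sum_range_succ _ (i + 1), add_comm]

theorem shiftSolution_subdiag (h : ℕ → ℕ → K) (i : ℕ) :
    shiftSolution h (i + 2) i = ∑ k ∈ Finset.range (i + 1), h (k + 1) k := by
  induction i with
  | zero => simp [shiftSolution]
  | succ i ih => rw [shiftSolution, ih, Finset.sum_range_succ _ (i + 1), add_comm]

theorem shiftSolution_below (h : ℕ → ℕ → K) (hh : ∀ i j, j + 1 < i → h i j = 0) (i j : ℕ)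
    (hij : j + 2 < i) : shiftSolution h i j = 0 := by
  induction j generalizing i with
  | zero =>
    obtain ⟨i, rfl⟩ : ∃ k, i = k + 1 := ⟨i - 1, by omega⟩
    exact hh _ _ (by omega)
  | succ j ih =>
    obtain ⟨i, rfl⟩ : ∃ k, i = k + 1 := ⟨i - 1, by omega⟩
    rw [shiftSolution, hh _ _ (by omega), ih _ (by omega), add_zero]

theorem superdiagonal_mul_apply {m : ℕ} (y : ℕ → ℕ → K) (i j : Fin m) :
    (superdiagonal K m * of fun i j : Fin m => y i j) i j =
      if (i : ℕ) + 1 < m then y (i + 1) j else 0 := by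
  simp only [superdiagonal, mul_apply, of_apply, ite_mul, one_mul, zero_mul]
  split_ifs with h
  · rw [Finset.sum_eq_single ⟨i + 1, h⟩] <;> grind
  · exact Finset.sum_eq_zero fun k _ => if_neg (by omega)

theorem mul_superdiagonal_apply {m : ℕ} (y : ℕ → ℕ → K) (i j : Fin m) :
    ((of fun i j : Fin m => y i j) * superdiagonal K m) i j =
      if (j : ℕ) = 0 then 0 else y i (j - 1) := by
  simp only [superdiagonal, mul_apply, of_apply, mul_ite, mul_one, mul_zero]
  split_ifs with h
  · exact Finset.sum_eq_zero fun k _ => if_neg (by omega)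
  · rw [Finset.sum_eq_single ⟨j - 1, by omega⟩] <;> grind

theorem IsHessenberg.exists_superdiagonal_commutator {m : ℕ} {H : Matrix (Fin m) (Fin m) K}
    (hH : IsHessenberg H) (htr : H.trace = 0) (hsub : (H * superdiagonal K m).trace = 0) :
    ∃ Y, H = superdiagonal K m * Y - Y * superdiagonal K m := by
  let h : ℕ → ℕ → K := fun i j => if hij : i < m ∧ j < m then H ⟨i, hij.1⟩ ⟨j, hij.2⟩ else 0
  have hH_eq : H = of fun i j : Fin m => h i j := by ext i j; simp [h]
  have hh : ∀ i j, j + 1 < i → h i j = 0 := by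
    intro i j hij
    simp only [h]
    split_ifs with hb
    · exact hH _ _ hij
    · rfl
  have hlast : ∀ j < m, shiftSolution h m j = 0 := by
    intro j hj
    rcases (by omega : m = j + 1 ∨ m = j + 2 ∨ j + 2 < m) with rfl | rfl | hlt
    · rw [shiftSolution_diag, Finset.sum_range, ← htr, trace]
      exact Finset.sum_congr rfl fun k _ => by simp [h, Nat.lt_succ_iff.mp k.2]
    · rw [shiftSolution_subdiag, ← hsub, trace, Fin.sum_univ_succ, hH_eq]
      simp only [diag_apply, mul_superdiagonal_apply]
      simp [Finset.sum_range]
    · exact shiftSolution_below h hh _ _ hlt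
  refine ⟨of fun i j : Fin m => shiftSolution h i j, ?_⟩
  ext i j
  rw [Matrix.sub_apply, superdiagonal_mul_apply, mul_superdiagonal_apply]
  have key : H i j = shiftSolution h (i + 1) j -
      if (j : ℕ) = 0 then 0 else shiftSolution h i (j - 1) := by
    rw [hH_eq, of_apply]
    rcases hj : (j : ℕ) with _ | k <;> simp [shiftSolution]
  rw [key]
  split_ifs with h1 h2 h2
  all_goals try rfl
  all_goals
    have hi : (i : ℕ) + 1 = m := by omega
    rw [hi, hlast _ j.2]

theorem exists_linearEquiv_apply_eq {ι V : Type*} [Finite ι] [AddCommGroup V] [Module K V]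
    {u w : ι → V} (hu : LinearIndependent K u) (hw : LinearIndependent K w) :
    ∃ g : V ≃ₗ[K] V, ∀ i, g (u i) = w i := by
  have : FiniteDimensional K (Submodule.span K (Set.range u)) :=
    FiniteDimensional.span_of_finite K (Set.finite_range _)
  obtain ⟨g, hg⟩ := Submodule.exists_linearEquiv_restrict_eq
    (hu.linearCombinationEquiv.symm ≪≫ₗ hw.linearCombinationEquiv)
  refine ⟨g, fun i => ?_⟩
  have hui : (hu.linearCombinationEquiv (Finsupp.single i 1) : V) = u i := by simp
  rw [← hui, ← hg]
  simp

theorem exists_invertible_mulVec_eq {ι : Type*} [Finite ι] {m : ℕ} {u w : ι → Fin m → K}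
    (hu : LinearIndependent K u) (hw : LinearIndependent K w) :
    ∃ P Q : Matrix (Fin m) (Fin m) K, P * Q = 1 ∧ ∀ i, P *ᵥ u i = w i := by
  obtain ⟨g, hg⟩ := exists_linearEquiv_apply_eq hu hw
  refine ⟨LinearMap.toMatrix' g.toLinearMap, LinearMap.toMatrix' g.symm.toLinearMap, ?_, ?_⟩
  · rw [← LinearMap.toMatrix'_comp]
    simp
  · intro i
    rw [LinearMap.toMatrix'_mulVec]
    exact hg i

/-- Reduction to Hessenberg form by a change of basis that moves a given vector to the line of the
first basis vector. -/
theorem exists_conj_isHessenberg {m : ℕ} (A : Matrix (Fin m) (Fin m) K) (c : Fin m → K) :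
    ∃ P Q : Matrix (Fin m) (Fin m) K, P * Q = 1 ∧ IsHessenberg (Q * A * P) ∧
      ∀ i : Fin m, (i : ℕ) ≠ 0 → (Q *ᵥ c) i = 0 := by
  induction m with
  | zero => exact ⟨1, 1, by simp, fun i => i.elim0, fun i => i.elim0⟩
  | succ m ih =>
    obtain ⟨P₀, Q₀, h₀, t, ht⟩ : ∃ P Q : Matrix (Fin (m + 1)) (Fin (m + 1)) K, P * Q = 1 ∧
        ∃ t : K, Q *ᵥ c = Pi.single 0 t := by
      by_cases hc : c = 0
      · exact ⟨1, 1, by simp, 0, by simp [hc]⟩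
      · obtain ⟨P, Q, hPQ, h⟩ := exists_invertible_mulVec_eq (ι := Unit)
          (u := fun _ => Pi.single (0 : Fin (m + 1)) (1 : K)) (w := fun _ => c)
          (by rw [linearIndependent_unique_iff]; simp)
          (by rw [linearIndependent_unique_iff]; exact hc)
        refine ⟨P, Q, hPQ, 1, ?_⟩
        rw [← h (), mulVec_mulVec, mul_eq_one_comm.mp hPQ, one_mulVec]
    obtain ⟨a, r, d, B, hB⟩ : ∃ a r d B, Q₀ * A * P₀ = bordered a r d B :=
      ⟨_, _, _, _, eq_bordered _⟩
    obtain ⟨P, Q, hPQ, hH, hd⟩ := ih B d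
    refine ⟨P₀ * bordered 1 0 0 P, bordered 1 0 0 Q * Q₀, ?_, ?_, ?_⟩
    · calc _ = P₀ * (bordered 1 0 0 P * bordered 1 0 0 Q) * Q₀ := by simp only [mul_assoc]
        _ = 1 := by simp [bordered_mul, hPQ, bordered_one, h₀]
    · have : bordered 1 0 0 Q * Q₀ * A * (P₀ * bordered 1 0 0 P) =
          bordered a (r ᵥ* P) (Q *ᵥ d) (Q * B * P) := by
        calc _ = bordered 1 0 0 Q * (Q₀ * A * P₀) * bordered 1 0 0 P := by simp only [mul_assoc]
          _ = _ := by simp [hB, bordered_mul]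
      rw [this]
      intro i j
      refine Fin.cases ?_ (fun i => ?_) i <;> refine Fin.cases ?_ (fun j => ?_) j <;> intro hij
      · simp at hij
      · simp at hij
      · exact hd i (by simpa [Nat.pos_iff_ne_zero] using hij)
      · exact hH i j (by simpa using hij)
    · intro i
      refine Fin.cases (by simp) (fun i => ?_) i
      rw [← mulVec_mulVec, ht]
      simp

/-- A bordered matrix with zero corner is a commutator if its block is the commutator of a
matrix `N` with `1 - N` invertible. -/
theorem isCommutator_bordered {m : ℕ} (r c : Fin m → K) {N Y : Matrix (Fin m) (Fin m) K}
    (hN : IsUnit (1 - N)) : IsCommutator (bordered 0 r c (N * Y - Y * N)) := by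
  have hdet := (isUnit_iff_isUnit_det _).mp hN
  refine ⟨bordered 1 0 0 N, bordered 0 (r ᵥ* (1 - N)⁻¹) (-((1 - N)⁻¹ *ᵥ c)) Y, ?_⟩
  have hr : r ᵥ* (1 - N)⁻¹ - (r ᵥ* (1 - N)⁻¹) ᵥ* N = r := by
    rw [← vecMul_one (r ᵥ* (1 - N)⁻¹), vecMul_vecMul _ 1 N, one_mul, ← vecMul_sub,
      vecMul_vecMul, nonsing_inv_mul _ hdet, vecMul_one]
  have hc : (1 - N)⁻¹ *ᵥ c - N *ᵥ ((1 - N)⁻¹ *ᵥ c) = c := by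
    conv_lhs => rw [← one_mulVec ((1 - N)⁻¹ *ᵥ c), mulVec_mulVec _ N 1, mul_one, ← sub_mulVec]
    rw [mulVec_mulVec, mul_nonsing_inv _ hdet, one_mulVec]
  rw [bordered_mul, bordered_mul, bordered_sub]
  congr 1
  · simp
  · simpa using hr.symm
  · simpa [mulVec_neg, neg_add_eq_sub] using hc.symm
  · simp

/-- A matrix admitting a vector that is linearly independent of its image is similar to a matrix
whose corner vanishes, whose first column is supported in row one, and whose lower right block is
Hessenberg. -/
theorem exists_conj_bordered_isHessenberg {m : ℕ} (A : Matrix (Fin (m + 2)) (Fin (m + 2)) K)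
    {v : Fin (m + 2) → K} (hv : LinearIndependent K ![v, A *ᵥ v]) :
    ∃ P Q : Matrix (Fin (m + 2)) (Fin (m + 2)) K, P * Q = 1 ∧
      ∃ r t H, t ≠ 0 ∧ IsHessenberg H ∧
        Q * A * P = bordered 0 r (Pi.single (0 : Fin (m + 1)) t) H := by
  have he : LinearIndependent K
      ![(Pi.single 0 1 : Fin (m + 2) → K), (Pi.single 1 1 : Fin (m + 2) → K)] := by
    rw [LinearIndependent.pair_iff]
    intro a b hab
    exact ⟨by simpa using congrFun hab 0, by simpa using congrFun hab 1⟩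
  obtain ⟨P₀, Q₀, h₀, hP₀⟩ := exists_invertible_mulVec_eq he hv
  have hcol : (Q₀ * A * P₀) *ᵥ Pi.single 0 1 = Pi.single (1 : Fin (m + 2)) (1 : K) := by
    have h0 : P₀ *ᵥ Pi.single 0 1 = v := hP₀ 0
    have h1 : P₀ *ᵥ Pi.single 1 1 = A *ᵥ v := hP₀ 1
    rw [← mulVec_mulVec, h0, ← mulVec_mulVec, ← h1, mulVec_mulVec, mul_eq_one_comm.mp h₀,
      one_mulVec]
  obtain ⟨r, B, hB⟩ : ∃ r B,
      Q₀ * A * P₀ = bordered 0 r (Pi.single (0 : Fin (m + 1)) 1) B := by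
    rw [mulVec_single_one] at hcol
    have h0 : (Q₀ * A * P₀) 0 0 = 0 := by simpa using congrFun hcol 0
    have hsucc : (fun i : Fin (m + 1) => (Q₀ * A * P₀) i.succ 0) = Pi.single 0 1 := by
      ext i
      refine (congrFun hcol i.succ).trans ?_
      rw [← Fin.succ_zero_eq_one, Pi.single_apply, Pi.single_apply]
      simp only [Fin.succ_inj]
    have h := eq_bordered (Q₀ * A * P₀)
    rw [h0, hsucc] at h
    exact ⟨_, _, h⟩
  obtain ⟨P, Q, hPQ, hH, hc⟩ := exists_conj_isHessenberg B (Pi.single 0 1)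
  have hQ : Q *ᵥ Pi.single 0 1 = Pi.single 0 (Q 0 0) := by
    ext i
    refine Fin.cases (by simp) (fun i => ?_) i
    rw [hc _ (by simp)]
    simp
  refine ⟨P₀ * bordered 1 0 0 P, bordered 1 0 0 Q * Q₀, ?_, r ᵥ* P, Q 0 0, Q * B * P, ?_, hH, ?_⟩
  · calc _ = P₀ * (bordered 1 0 0 P * bordered 1 0 0 Q) * Q₀ := by simp only [mul_assoc]
      _ = 1 := by simp [bordered_mul, hPQ, bordered_one, h₀]
  · intro h
    rw [h, Pi.single_zero] at hQ
    have h1 : (Pi.single 0 1 : Fin (m + 1) → K) = P *ᵥ (Q *ᵥ Pi.single 0 1) := by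
      rw [mulVec_mulVec, hPQ, one_mulVec]
    rw [hQ, mulVec_zero] at h1
    simpa using congrFun h1 0
  · calc _ = bordered 1 0 0 Q * (Q₀ * A * P₀) * bordered 1 0 0 P := by simp only [mul_assoc]
      _ = _ := by simp [hB, bordered_mul, hQ]

theorem isCommutator_bordered_isHessenberg {m : ℕ} (r : Fin (m + 1) → K) {t : K} (ht : t ≠ 0)
    {H : Matrix (Fin (m + 1)) (Fin (m + 1)) K} (hH : IsHessenberg H) (htr : H.trace = 0) :
    IsCommutator (bordered 0 r (Pi.single 0 t) H) := by
  by_cases hs : (H * superdiagonal K (m + 1)).trace = 0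
  · obtain ⟨Y, hY⟩ := hH.exists_superdiagonal_commutator htr hs
    rw [hY]
    exact isCommutator_bordered _ _ (isUnit_one_sub_superdiagonal _)
  set σ := (H * superdiagonal K (m + 1)).trace with hσ
  obtain ⟨x, hx, hxt⟩ : ∃ x : K, x ≠ 0 ∧ x * t = -σ :=
    ⟨-σ / t, div_ne_zero (neg_ne_zero.mpr hs) ht, div_mul_cancel₀ _ ht⟩
  refine IsCommutator.of_conj (P := bordered x 0 0 1) (Q := bordered x⁻¹ 0 0 1)
    (by simp [bordered_mul, mul_inv_cancel₀ hx, bordered_one]) ?_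
  have hconj : bordered x⁻¹ 0 0 1 * bordered 0 r (Pi.single 0 t) H *
      bordered x 0 0 1 = bordered 0 (x⁻¹ • r) (Pi.single 0 (-σ)) H := by
    have hsingle : x • (Pi.single 0 t : Fin (m + 1) → K) = Pi.single 0 (-σ) := by
      rw [← Pi.single_smul, smul_eq_mul, hxt]
    simp only [bordered_mul]
    simp [-mulVec_single, hsingle]
  rw [hconj]
  have hHess : IsHessenberg (bordered 0 (x⁻¹ • r) (Pi.single 0 (-σ)) H) := by
    intro i j
    refine Fin.cases ?_ (fun i => ?_) i <;> refine Fin.cases ?_ (fun j => ?_) j <;> intro hij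
    · simp at hij
    · simp at hij
    · have : i ≠ 0 := by
        rintro rfl
        simp at hij
      simp [this]
    · exact hH i j (by simpa using hij)
  obtain ⟨Y, hY⟩ := hHess.exists_superdiagonal_commutator (by simp [trace_bordered, htr]) (by
    rw [superdiagonal_succ, bordered_mul, trace_bordered, trace_add, ← hσ, trace_vecMulVec]
    simp)
  exact ⟨_, Y, hY⟩

theorem isCommutator_of_trace_eq_zero {m : ℕ} (A : Matrix (Fin (m + 2)) (Fin (m + 2)) K)
    (hA : A.trace = 0) : IsCommutator A := by
  by_cases hli : ∀ v, ¬ LinearIndependent K ![v, A *ᵥ v]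
  · obtain ⟨a, ha⟩ := LinearMap.exists_eq_smul_id_of_forall_notLinearIndependent
      (f := A.mulVecLin) hli
    have hAa : A = a • 1 := by
      rw [← toLin'_apply'] at ha
      simpa using congrArg LinearMap.toMatrix' ha
    have hH : IsHessenberg A := by
      intro i j hij
      have : i ≠ j := by omega
      simp [hAa, this]
    obtain ⟨Y, hY⟩ := hH.exists_superdiagonal_commutator hA (by
      simp [hAa, trace, superdiagonal])
    exact ⟨_, Y, hY⟩
  · push Not at hli
    obtain ⟨v, hv⟩ := hli
    obtain ⟨P, Q, hPQ, r, t, H, ht, hH, hconj⟩ := exists_conj_bordered_isHessenberg A hv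
    refine IsCommutator.of_conj hPQ ?_
    have htr : H.trace = 0 := by
      have : (Q * A * P).trace = 0 := by
        rw [mul_assoc, trace_mul_comm, mul_assoc, hPQ, mul_one, hA]
      rwa [hconj, trace_bordered, zero_add] at this
    rw [hconj]
    exact isCommutator_bordered_isHessenberg r ht hH htr

end

theorem commutators_eq_trace_zero (K : Type*) [Field K] (n : ℕ) (hn : 2 ≤ n) :
    {M : Matrix (Fin n) (Fin n) K | ∃ A B : Matrix (Fin n) (Fin n) K, M = A * B - B * A} =
      {M : Matrix (Fin n) (Fin n) K | Matrix.trace M = 0} := by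
  obtain ⟨m, rfl⟩ : ∃ m, n = m + 2 := ⟨n - 2, by omega⟩
  ext M
  refine ⟨?_, isCommutator_of_trace_eq_zero M⟩
  rintro ⟨A, B, rfl⟩
  change (A * B - B * A).trace = 0
  rw [trace_sub, trace_mul_comm, sub_self]
end

section
/- Let K be an algebraically closed field and n ≥ 2 an integer. Then the set {B^n | B ∈ M_n(K)} is not a K-linear subspace of M_n(K). -/
theorem Matrix.pow_card_eq_zero_of_isNilpotent {m R : Type*} [Fintype m] [DecidableEq m]
    [CommRing R] [IsReduced R] {B : Matrix m m R} (hB : IsNilpotent B) :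
    B ^ Fintype.card m = 0 := by
  have h : B.charpoly - Polynomial.X ^ Fintype.card m = 0 := Polynomial.ext fun k =>
    (Polynomial.isNilpotent_iff.mp
      (Matrix.isNilpotent_charpoly_sub_pow_of_isNilpotent hB) k).eq_zero
  have hc := Matrix.aeval_self_charpoly B
  rwa [sub_eq_zero.mp h, map_pow, Polynomial.aeval_X] at hc

theorem nth_powers_not_subspace (K : Type*) [Field K] [IsAlgClosed K] (n : ℕ) (hn : 2 ≤ n) :
    ¬ ∃ S : Submodule K (Matrix (Fin n) (Fin n) K),
        (S : Set (Matrix (Fin n) (Fin n) K)) =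
          {M : Matrix (Fin n) (Fin n) K | ∃ B : Matrix (Fin n) (Fin n) K, M = B ^ n} := by
  rintro ⟨S, hS⟩
  have mem_of_idem (P : Matrix (Fin n) (Fin n) K) (hP : IsIdempotentElem P) : P ∈ S := by
    rw [← SetLike.mem_coe, hS]
    exact ⟨P, (hP.pow_eq (by omega)).symm⟩
  let i : Fin n := ⟨0, by omega⟩
  let j : Fin n := ⟨1, by omega⟩
  have hij : j ≠ i := by simp [i, j]
  have hE : Matrix.single i j (1 : K) ∈ S := by
    have h := S.sub_mem
      (mem_of_idem (Matrix.single i i 1 + Matrix.single i j 1)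
        (by simp [IsIdempotentElem, mul_add, add_mul, hij]))
      (mem_of_idem (Matrix.single i i 1) (by simp [IsIdempotentElem]))
    rwa [add_sub_cancel_left] at h
  rw [← SetLike.mem_coe, hS] at hE
  obtain ⟨B, hB⟩ := hE
  have hnil : IsNilpotent B :=
    ⟨n * 2, by rw [pow_mul, ← hB, sq]; simp [hij]⟩
  have hzero := Matrix.pow_card_eq_zero_of_isNilpotent hnil
  rw [Fintype.card_fin, ← hB] at hzero
  simpa using congrFun (congrFun hzero i) j
end

section
/- Let K be a field, n ≥ 2 an integer, and a, b ∈ K. Then the set S = {aXY + bYX | X, Y ∈ M_n(K)} is one of the following three sets: {0}, the set of matrices in M_n(K) with trace 0, or all of M_n(K). Specifically: if a = b = 0 then S = {0}; if a + b ≠ 0 then S = M_n(K); and if a + b = 0 with a ≠ 0 then S equals the set of trace-zero matrices. -/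
/-- Sums of `m` along diagonals, in steps of two. -/
def stepSum {K : Type*} [AddCommMonoid K] (m : ℕ → ℕ → K) : ℕ → ℕ → K
  | i + 2, j + 2 => m (i + 2) (j + 2) + stepSum m i j
  | i, j => m i j

/-- The solution `y` of `±y i j + y (i + 2) j - y i (j - 2) = m i j`, with sign given by the parity
of `i`, that vanishes for `i ≥ n` and for `j < 0`. -/
def crossEntry {K : Type*} [Ring K] (n : ℕ) (m : ℕ → ℕ → K) (i j : ℕ) : K :=
  if n ≤ i then 0 else
    (if Even i then 1 else -1) *
      (m i j - crossEntry n m (i + 2) j + if 2 ≤ j then crossEntry n m i (j - 2) else 0)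
termination_by (n - i) + j

theorem stepSum_eq_zero {K : Type*} [AddCommMonoid K] {m : ℕ → ℕ → K}
    (hm : ∀ i j, j + 1 < i → m i j = 0) :
    ∀ i j, j + 1 < i → stepSum m i j = 0
  | i + 2, j + 2, h => by
    rw [stepSum, hm _ _ h, stepSum_eq_zero hm i j (by omega), add_zero]
  | i + 2, 0, h => by simpa [stepSum] using hm _ _ h
  | i + 2, 1, h => by simpa [stepSum] using hm _ _ h

theorem stepSum_add_succ {K : Type*} [AddCommMonoid K] (m : ℕ → ℕ → K) (k : ℕ) :
    stepSum m k k + stepSum m (k + 1) (k + 1) = ∑ i ∈ Finset.range (k + 2), m i i := by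
  induction k with
  | zero => simp [stepSum, Finset.sum_range_succ]
  | succ k ih => rw [Finset.sum_range_succ, ← ih, stepSum]; abel

theorem exists_commutator_of_stepSum {K : Type*} [Field K] {k : ℕ} (m : ℕ → ℕ → K)
    (hm : ∀ i j, j + 1 < i → m i j = 0)
    (h₀ : stepSum m k k = 0) (h₁ : stepSum m (k + 1) (k + 1) = 0) :
    ∃ X Y : Matrix (Fin (k + 2)) (Fin (k + 2)) K,
      Matrix.of (fun i j : Fin (k + 2) => m i j) = X * Y - Y * X := by
  let c : ℕ → K := fun i => if Even i then 1 else 0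
  let y : ℕ → ℕ → K := fun i j =>
    if (Even i ↔ Even j) then (if 2 ≤ i then stepSum m (i - 2) j else 0)
    else crossEntry (k + 2) m i j
  have shift (a : ℕ) (F : ℕ → K) :
      ∑ l : Fin (k + 2), (if (l : ℕ) = a then F l else 0) = if a < k + 2 then F a else 0 := by
    rw [Fin.sum_univ_eq_sum_range (fun l => if l = a then F l else 0)]
    simp
  refine ⟨Matrix.diagonal (fun i : Fin (k + 2) => c i) + Matrix.of fun i j : Fin (k + 2) => if (j : ℕ) = i + 2 then (1 : K) else 0,
    Matrix.of fun i j : Fin (k + 2) => y i j, ?_⟩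
  ext i j
  rw [add_mul, mul_add, Matrix.sub_apply, Matrix.add_apply, Matrix.add_apply,
    Matrix.diagonal_mul, Matrix.mul_diagonal, Matrix.mul_apply, Matrix.mul_apply]
  have e₁ : ∑ l : Fin (k + 2), Matrix.of (fun i j : Fin (k + 2) =>
      if (j : ℕ) = i + 2 then (1 : K) else 0) i l * Matrix.of (fun i j : Fin (k + 2) => y i j) l j
      = if (i : ℕ) + 2 < k + 2 then y (i + 2) j else 0 := by
    rw [← shift (i + 2) (fun l => y l j)]
    simp
  have e₂ : ∑ l : Fin (k + 2), Matrix.of (fun i j : Fin (k + 2) => y i j) i l *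
      Matrix.of (fun i j : Fin (k + 2) => if (j : ℕ) = i + 2 then (1 : K) else 0) l j
      = if 2 ≤ (j : ℕ) then y i (j - 2) else 0 := by
    split_ifs with h
    · have := shift (j - 2) (fun l => y i l)
      rw [if_pos (by omega)] at this
      rw [← this]
      refine Finset.sum_congr rfl fun l _ => ?_
      have : (j : ℕ) = l + 2 ↔ (l : ℕ) = j - 2 := by omega
      simp [this]
    · refine Finset.sum_eq_zero fun l _ => ?_
      have : (j : ℕ) ≠ l + 2 := by omega
      simp [this]
  rw [e₁, e₂]
  simp only [Matrix.of_apply]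
  obtain ⟨i, hi⟩ := i
  obtain ⟨j, hj⟩ := j
  simp only
  have par (a : ℕ) : Even (a + 2) ↔ Even a := by simp [Nat.even_add]
  have par' (a : ℕ) (h : 2 ≤ a) : Even (a - 2) ↔ Even a := by simp [Nat.even_sub h]
  by_cases hij : Even i ↔ Even j
  · have hc : c i = c j := by simp [c, hij]
    have hstep : stepSum m i j = m i j + if 2 ≤ j then y i (j - 2) else 0 := by
      by_cases h2 : 2 ≤ j
      · obtain ⟨j, rfl⟩ := Nat.exists_eq_add_of_le' h2
        rw [par] at hij
        by_cases h2' : 2 ≤ i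
        · obtain ⟨i, rfl⟩ := Nat.exists_eq_add_of_le' h2'
          simp [y, hij, stepSum]
        · have : i = 0 ∨ i = 1 := by omega
          rcases this with rfl | rfl <;> simp only [y, stepSum] <;>
            simp [hij]
      · have : j = 0 ∨ j = 1 := by omega
        rcases this with rfl | rfl <;> simp [stepSum]
    have hy : (if i + 2 < k + 2 then y (i + 2) j else 0) = stepSum m i j := by
      split_ifs with h
      · simp [y, par, hij]
      · have hodd (a : ℕ) : Even (a + 1) ↔ ¬ Even a := Nat.even_add_one
        symm
        rcases lt_trichotomy i j with hlt | rfl | hlt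
        · obtain rfl : i = k := by omega
          obtain rfl : j = i + 1 := by omega
          exact absurd (hodd i) (by tauto)
        · have : i = k ∨ i = k + 1 := by omega
          rcases this with rfl | rfl <;> assumption
        · refine stepSum_eq_zero hm _ _ ?_
          by_contra hne
          obtain rfl : i = j + 1 := by omega
          exact absurd (hodd j) (by tauto)
    rw [hy, hstep, hc]
    ring
  · have hy : y i j = crossEntry (k + 2) m i j := by simp [y, hij]
    have h1 : (if i + 2 < k + 2 then y (i + 2) j else 0) = crossEntry (k + 2) m (i + 2) j := by
      split_ifs with h
      · simp [y, par, hij]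
      · rw [crossEntry, if_pos (by omega)]
    have h2 : (if 2 ≤ j then y i (j - 2) else 0) =
        if 2 ≤ j then crossEntry (k + 2) m i (j - 2) else 0 := by
      split_ifs with h
      · simp [y, par' _ h, hij]
      · rfl
    rw [h1, h2, hy, crossEntry, if_neg (by omega)]
    by_cases hi' : Even i
    · have hj' : ¬ Even j := by tauto
      simp only [c, hi', hj', if_true, if_false]
      ring
    · have hj' : Even j := by tauto
      simp only [c, hi', hj', if_true, if_false]
      ring

theorem stepSum_shear {K : Type*} [CommRing K] {m m' : ℕ → ℕ → K} {δ : K}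
    (h₀ : m' 0 0 = m 0 0 - δ) (h₁ : m' 1 1 = m 1 1 + δ)
    (h : ∀ i, m' (i + 2) (i + 2) = m (i + 2) (i + 2)) (i : ℕ) :
    stepSum m' i i = stepSum m i i + if Even i then -δ else δ := by
  induction i using Nat.twoStepInduction with
  | zero => simp [stepSum, h₀, sub_eq_add_neg]
  | one => simp [stepSum, h₁]
  | more i ih _ =>
    have : Even (i + 2) ↔ Even i := by simp [Nat.even_add]
    simp only [stepSum, h, ih, this, add_assoc]

theorem exists_commutator_of_hessenberg {K : Type*} [Field K] {k : ℕ}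
    (N : Matrix (Fin (k + 2)) (Fin (k + 2)) K)
    (hN : ∀ i j : Fin (k + 2), (j : ℕ) + 1 < i → N i j = 0) (h10 : N 1 0 ≠ 0)
    (htr : N.trace = 0) :
    ∃ X Y : Matrix (Fin (k + 2)) (Fin (k + 2)) K, N = X * Y - Y * X := by
  let m : ℕ → ℕ → K := fun i j =>
    if h : i < k + 2 ∧ j < k + 2 then N ⟨i, h.1⟩ ⟨j, h.2⟩ else 0
  have hmN (i j : Fin (k + 2)) : m i j = N i j := by simp [m]
  have hm (i j : ℕ) (hij : j + 1 < i) : m i j = 0 := by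
    simp only [m]
    split_ifs with h
    · exact hN _ _ hij
    · rfl
  have hm10 : m 1 0 = N 1 0 := hmN 1 0
  have hsum : stepSum m k k + stepSum m (k + 1) (k + 1) = 0 := by
    rw [stepSum_add_succ, ← Fin.sum_univ_eq_sum_range (fun i => m i i), ← htr]
    exact Finset.sum_congr rfl fun i _ => hmN i i
  obtain ⟨c, hc⟩ : ∃ c, stepSum m k k + (if Even k then -(c * m 1 0) else c * m 1 0) = 0 := by
    rw [hm10]
    split_ifs
    · exact ⟨stepSum m k k / N 1 0, by field_simp; ring⟩
    · exact ⟨-stepSum m k k / N 1 0, by field_simp; ring⟩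
  let m' : ℕ → ℕ → K := fun i j =>
    m i j + (if j = 1 then c * m i 0 else 0)
      - if i = 0 then c * (m 1 j + if j = 1 then c * m 1 0 else 0) else 0
  have hshear := stepSum_shear (m := m) (m' := m') (δ := c * m 1 0)
    (by simp [m']) (by simp [m']) (by simp [m'])
  obtain ⟨X, Y, hXY⟩ := exists_commutator_of_stepSum (k := k) m'
    (fun i j hij => by
      have hi : i ≠ 0 := by omega
      simp only [m', hm i j hij, hi, if_false]
      split_ifs
      · simp [hm i 0 (by omega)]
      · simp)
    (by rw [hshear, hc])
    (by
      rw [hshear]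
      by_cases hk : Even k <;> simp only [Nat.even_add_one, hk, not_true, not_false_iff,
        if_true, if_false] at hc ⊢ <;> linear_combination hsum - hc)
  let T (c : K) : Matrix (Fin (k + 2)) (Fin (k + 2)) K := Matrix.transvection 0 1 c
  have hT (c d : K) (h : c + d = 0) : T c * T d = 1 := by
    simp [T, Matrix.transvection_mul_transvection_same, h]
  have hconj : Matrix.of (fun i j : Fin (k + 2) => m' i j) = T (-c) * (N * T c) := by
    ext i j
    have hi : (i : ℕ) = 0 ↔ i = 0 := Fin.val_eq_zero_iff
    have hj : (j : ℕ) = 1 ↔ j = 1 := by rw [Fin.ext_iff, Fin.val_one]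
    have e₁ := hmN i j
    have e₂ := hmN i 0
    have e₃ := hmN 1 j
    simp only [Fin.val_zero, Fin.val_one] at e₂ e₃
    simp only [Matrix.of_apply, m', hi, hj, e₁, e₂, e₃, hm10, T]
    by_cases h0 : i = 0 <;> by_cases h1 : j = 1 <;> simp [h0, h1] <;> ring
  have h1 := hT c (-c) (by ring)
  have h2 := hT (-c) c (by ring)
  refine ⟨T c * X * T (-c), T c * Y * T (-c), ?_⟩
  calc N = (T c * T (-c)) * N * (T c * T (-c)) := by rw [h1, one_mul, mul_one]
    _ = T c * (T (-c) * (N * T c)) * T (-c) := by simp only [mul_assoc]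
    _ = T c * (X * Y - Y * X) * T (-c) := by rw [← hconj, hXY]
    _ = T c * X * (T (-c) * T c) * Y * T (-c) - T c * Y * (T (-c) * T c) * X * T (-c) := by
      rw [h2]; noncomm_ring
    _ = _ := by simp only [mul_assoc]

open Module in
theorem exists_hessenberg_seq {K V : Type*} [Field K] [AddCommGroup V] [Module K V]
    [FiniteDimensional K V] (f : End K V) {v : V} (hv : LinearIndependent K ![v, f v]) (k : ℕ)
    (hk : k + 2 ≤ finrank K V) :
    ∃ b : ℕ → V, LinearIndependent K (fun i : Fin (k + 2) => b i) ∧ b 1 = f (b 0) ∧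
      ∀ j < k + 1, f (b j) ∈ Submodule.span K (b '' Set.Iic (j + 1)) := by
  induction k with
  | zero =>
    refine ⟨fun i => if i = 0 then v else f v, ?_, by simp, ?_⟩
    · convert hv using 1
      ext i
      fin_cases i <;> simp
    · intro j hj
      obtain rfl : j = 0 := by omega
      exact Submodule.subset_span ⟨1, by simp, by simp⟩
  | succ k ih =>
    obtain ⟨b, hb, hb1, hf⟩ := ih (by omega)
    set W := Submodule.span K (Set.range fun i : Fin (k + 2) => b i) with hW
    have hWlt : W < ⊤ := by
      refine Submodule.lt_top_of_finrank_lt_finrank ?_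
      rw [hW, finrank_span_eq_card hb, Fintype.card_fin]
      omega
    obtain ⟨x, hx, hfx⟩ : ∃ x, x ∉ W ∧ (f (b (k + 1)) ∈ W ∨ f (b (k + 1)) = x) := by
      by_cases h : f (b (k + 1)) ∈ W
      · obtain ⟨x, -, hx⟩ := SetLike.exists_of_lt hWlt
        exact ⟨x, hx, .inl h⟩
      · exact ⟨_, h, .inr rfl⟩
    have hne (i : ℕ) (hi : i < k + 2) : Function.update b (k + 2) x i = b i :=
      Function.update_of_ne (by omega) _ _
    refine ⟨Function.update b (k + 2) x, ?_, ?_, ?_⟩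
    · rw [linearIndependent_finSucc']
      have : Fin.init (fun i : Fin (k + 1 + 2) => Function.update b (k + 2) x i) =
          fun i : Fin (k + 2) => b i := by
        ext i
        exact hne i i.2
      rw [this]
      exact ⟨hb, by simpa using hx⟩
    · rw [hne 0 (by omega), hne 1 (by omega), hb1]
    · intro j hj
      rw [hne j (by omega)]
      rcases Nat.lt_succ_iff_lt_or_eq.mp hj with hj | rfl
      · convert hf j hj using 2
        exact Set.image_congr fun i hi => hne i (by simp at hi; omega)
      · rcases hfx with h | h
        · refine Submodule.span_mono ?_ h
          rintro _ ⟨i, rfl⟩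
          exact ⟨i, by simp only [Set.mem_Iic]; omega, hne i i.2⟩
        · exact Submodule.subset_span ⟨k + 2, by simp, by simp [h]⟩

theorem exists_commutator_smul_one {K : Type*} [Field K] (n : ℕ) (c : K)
    (h : (c • (1 : Matrix (Fin n) (Fin n) K)).trace = 0) :
    ∃ X Y : Matrix (Fin n) (Fin n) K, c • (1 : Matrix (Fin n) (Fin n) K) = X * Y - Y * X := by
  refine ⟨Matrix.of fun i j => if (j : ℕ) = i + 1 then 1 else 0,
    Matrix.of fun i j => if (i : ℕ) = j + 1 then c * i else 0, ?_⟩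
  have hc : c * n = 0 := by simpa using h
  have shift (a : ℕ) (F : ℕ → K) :
      ∑ l : Fin n, (if (l : ℕ) = a then F l else 0) = if a < n then F a else 0 := by
    rw [Fin.sum_univ_eq_sum_range (fun l => if l = a then F l else 0)]
    simp
  ext i j
  have e₁ : ∑ l : Fin n, (if (l : ℕ) = i + 1 then (1 : K) else 0) *
      (if (l : ℕ) = j + 1 then c * (l : ℕ) else 0) = if i = j then c * ((i : ℕ) + 1) else 0 := by
    have := shift (i + 1) (fun l => if l = (j : ℕ) + 1 then c * l else 0)
    simp only [ite_mul, one_mul, zero_mul]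
    rw [this]
    by_cases hij : i = j
    · subst hij
      by_cases hi : (i : ℕ) + 1 < n
      · simp [hi]
      · have : ((i : ℕ) : K) + 1 = n := by
          rw [← Nat.cast_succ]; congr 1; omega
        simp [hi, this, hc]
    · have : (i : ℕ) ≠ j := fun h => hij (Fin.ext h)
      simp [hij, this]
  have e₂ : ∑ l : Fin n, (if (i : ℕ) = l + 1 then c * (i : ℕ) else 0) *
      (if (j : ℕ) = l + 1 then (1 : K) else 0) = if i = j then c * (i : ℕ) else 0 := by
    have := shift (i - 1) (fun l => if (i : ℕ) = l + 1 then c * (i : ℕ) *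
      (if (j : ℕ) = l + 1 then (1 : K) else 0) else 0)
    rcases Nat.eq_zero_or_pos i with h0 | h0
    · simp [h0]
    · rw [if_pos (by omega), Nat.sub_add_cancel h0, if_pos rfl] at this
      convert this using 1
      · refine Finset.sum_congr rfl fun l _ => ?_
        have : (i : ℕ) = l + 1 ↔ (l : ℕ) = i - 1 := by omega
        simp only [this]
        split_ifs <;> simp
      · simp [Fin.ext_iff, eq_comm]
  simp only [Matrix.sub_apply, Matrix.mul_apply, Matrix.of_apply, Matrix.smul_apply,
    Matrix.one_apply, e₁, e₂]
  split_ifs <;> simp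
  ring

/-- Every trace-zero matrix over a field is a commutator. -/
theorem exists_commutator_of_trace_eq_zero {K : Type*} [Field K] {n : ℕ}
    (M : Matrix (Fin n) (Fin n) K) (hM : M.trace = 0) :
    ∃ X Y : Matrix (Fin n) (Fin n) K, M = X * Y - Y * X := by
  let f := Matrix.toLinAlgEquiv' M
  by_cases hf : ∀ v, ¬ LinearIndependent K ![v, f v]
  · obtain ⟨c, hc⟩ := LinearMap.exists_eq_smul_id_of_forall_notLinearIndependent hf
    have : M = c • 1 := Matrix.toLinAlgEquiv'.injective (by rw [map_smul, map_one]; exact hc)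
    rw [this] at hM ⊢
    exact exists_commutator_smul_one n c hM
  · push Not at hf
    obtain ⟨v, hv⟩ := hf
    have hn : 2 ≤ n := by simpa using hv.fintype_card_le_finrank
    obtain ⟨k, rfl⟩ := Nat.exists_eq_add_of_le' hn
    obtain ⟨b, hb, hb1, hbf⟩ := exists_hessenberg_seq f hv k (by simp)
    let B := basisOfLinearIndependentOfCardEqFinrank hb (by simp)
    have hB (i : Fin (k + 2)) : B i = b i := by simp [B]
    let φ := LinearMap.toMatrixAlgEquiv B
    obtain ⟨X, Y, hXY⟩ := exists_commutator_of_hessenberg (φ f)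
      (fun i j hij => by
        have hmem := hbf j (by omega)
        have himg : b '' Set.Iic ((j : ℕ) + 1) = B '' {l | (l : ℕ) ≤ j + 1} := by
          ext x
          constructor
          · rintro ⟨l, hl, rfl⟩
            simp only [Set.mem_Iic] at hl
            exact ⟨⟨l, by omega⟩, hl, hB _⟩
          · rintro ⟨l, hl, rfl⟩
            exact ⟨l, hl, (hB l).symm⟩
        rw [himg, B.mem_span_image] at hmem
        rw [LinearMap.toMatrixAlgEquiv_apply, hB]
        by_contra hne
        have := hmem (Finsupp.mem_support_iff.mpr hne)
        simp only [Set.mem_ofPred_eq] at this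
        omega)
      (by
        have h0 : B 0 = b 0 := hB 0
        have h1 : B 1 = b 1 := hB 1
        rw [LinearMap.toMatrixAlgEquiv_apply, h0, ← hb1, ← h1]
        simp)
      (by
        rw [← hM, ← Matrix.trace_toLin'_eq M]
        exact (LinearMap.trace_eq_matrix_trace K B f).symm)
    refine ⟨Matrix.toLinAlgEquiv'.symm (φ.symm X), Matrix.toLinAlgEquiv'.symm (φ.symm Y), ?_⟩
    simp only [← map_mul, ← map_sub, ← hXY]
    simp [f]


theorem degree_two_multilinear_image (K : Type*) [Field K] (n : ℕ) (hn : 2 ≤ n) (a b : K) :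
    ({M : Matrix (Fin n) (Fin n) K | ∃ X Y : Matrix (Fin n) (Fin n) K,
        M = a • (X * Y) + b • (Y * X)} = {0} ∨
     {M : Matrix (Fin n) (Fin n) K | ∃ X Y : Matrix (Fin n) (Fin n) K,
        M = a • (X * Y) + b • (Y * X)} = {M : Matrix (Fin n) (Fin n) K | Matrix.trace M = 0} ∨
     {M : Matrix (Fin n) (Fin n) K | ∃ X Y : Matrix (Fin n) (Fin n) K,
        M = a • (X * Y) + b • (Y * X)} = Set.univ) ∧
    (a = 0 ∧ b = 0 →
      {M : Matrix (Fin n) (Fin n) K | ∃ X Y : Matrix (Fin n) (Fin n) K,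
        M = a • (X * Y) + b • (Y * X)} = {0}) ∧
    (a + b ≠ 0 →
      {M : Matrix (Fin n) (Fin n) K | ∃ X Y : Matrix (Fin n) (Fin n) K,
        M = a • (X * Y) + b • (Y * X)} = Set.univ) ∧
    (a + b = 0 → a ≠ 0 →
      {M : Matrix (Fin n) (Fin n) K | ∃ X Y : Matrix (Fin n) (Fin n) K,
        M = a • (X * Y) + b • (Y * X)} = {M : Matrix (Fin n) (Fin n) K | Matrix.trace M = 0}) := by
  have h₀ : a = 0 ∧ b = 0 →
      {M : Matrix (Fin n) (Fin n) K | ∃ X Y : Matrix (Fin n) (Fin n) K,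
        M = a • (X * Y) + b • (Y * X)} = {0} := by
    rintro ⟨rfl, rfl⟩
    ext M
    simp
  have h₁ : a + b ≠ 0 →
      {M : Matrix (Fin n) (Fin n) K | ∃ X Y : Matrix (Fin n) (Fin n) K,
        M = a • (X * Y) + b • (Y * X)} = Set.univ := by
    refine fun h => Set.eq_univ_of_forall fun M => ⟨(a + b)⁻¹ • M, 1, ?_⟩
    rw [mul_one, one_mul, ← add_smul, smul_inv_smul₀ h]
  have h₂ : a + b = 0 → a ≠ 0 →
      {M : Matrix (Fin n) (Fin n) K | ∃ X Y : Matrix (Fin n) (Fin n) K,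
        M = a • (X * Y) + b • (Y * X)} = {M : Matrix (Fin n) (Fin n) K | Matrix.trace M = 0} := by
    intro h ha
    ext M
    constructor
    · rintro ⟨X, Y, rfl⟩
      rw [Set.mem_ofPred_eq, Matrix.trace_add, Matrix.trace_smul, Matrix.trace_smul,
        Matrix.trace_mul_comm Y X, ← add_smul, h, zero_smul]
    · intro hM
      obtain ⟨X, Y, rfl⟩ := exists_commutator_of_trace_eq_zero M hM
      refine ⟨a⁻¹ • X, Y, ?_⟩
      rw [eq_neg_of_add_eq_zero_right h, neg_smul, smul_mul_assoc, mul_smul_comm,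
        smul_inv_smul₀ ha, smul_inv_smul₀ ha, sub_eq_add_neg]
  refine ⟨?_, h₀, h₁, h₂⟩
  by_cases h : a + b = 0
  · by_cases ha : a = 0
    · exact .inl (h₀ ⟨ha, by simpa [ha] using h⟩)
    · exact .inr (.inl (h₂ h ha))
  · exact .inr (.inr (h₁ h))
end

section
/- Let K be a field, n ≥ 2 and m ≥ 1 integers with n ≥ m − 1, and a : S_m → K a nonzero function on the symmetric group S_m. Then the K-linear span of the set {∑_{σ∈S_m} a_σ A_{σ(1)} A_{σ(2)} ⋯ A_{σ(m)} | A_1,…,A_m ∈ M_n(K)} contains every matrix of trace 0 in M_n(K). -/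
/-- A product of a finite sequence vanishes as soon as two consecutive factors multiply to zero. -/
theorem List.prod_ofFn_eq_zero_of_consecutive {R : Type*} [MonoidWithZero R] {m : ℕ}
    (f : Fin (m + 1) → R) (i : Fin m) (h : f i.castSucc * f i.succ = 0) :
    (List.ofFn f).prod = 0 := by
  induction m with
  | zero => exact i.elim0
  | succ m ih =>
    rw [List.ofFn_succ, List.prod_cons]
    induction i using Fin.cases with
    | zero =>
      rw [List.ofFn_succ, List.prod_cons, ← mul_assoc]
      rw [show f 0 * f (Fin.succ 0) = 0 from h, zero_mul]
    | succ j => rw [ih (fun k => f k.succ) j h, mul_zero]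

/-- The product of the matrix units along a walk is the matrix unit joining its end points. -/
theorem Matrix.prod_ofFn_single_walk {K ι : Type*} [Semiring K] [Fintype ι] [DecidableEq ι]
    (v : ℕ → ι) (m : ℕ) :
    (List.ofFn fun i : Fin (m + 1) => Matrix.single (v i) (v (i + 1)) (1 : K)).prod =
      Matrix.single (v 0) (v (m + 1)) 1 := by
  induction m generalizing v with
  | zero => simp
  | succ m ih =>
    rw [List.ofFn_succ, List.prod_cons]
    have := ih (fun k => v (k + 1))
    simp only [Fin.val_succ, Fin.val_zero, this]
    simp

/-- A self-bijection of `Fin (m + 1)` that increases at each step is the identity. -/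
theorem Equiv.Perm.eq_one_of_castSucc_lt_succ {m : ℕ} (τ : Equiv.Perm (Fin (m + 1)))
    (h : ∀ i : Fin m, τ i.castSucc < τ i.succ) : τ = 1 := by
  have hmono : StrictMono τ := Fin.strictMono_iff_lt_succ.2 h
  have := Subsingleton.elim (hmono.orderIsoOfSurjective τ τ.surjective) (OrderIso.refl _)
  ext i
  exact congrArg Fin.val (DFunLike.congr_fun this i)

/-- Along the walk that visits the vertices `0, 0, 1, 1, 2, 2, …`, the only way of ordering the
edges so that the product of their matrix units is nonzero is the given one. -/
theorem Matrix.prod_ofFn_single_half_eq_zero {K ι : Type*} [Semiring K] [Fintype ι]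
    [DecidableEq ι] {m : ℕ} (v : ℕ → ι) (hv : Set.InjOn v {k | 2 * k ≤ m + 1})
    (τ : Equiv.Perm (Fin (m + 1))) (hτ : τ ≠ 1) :
    (List.ofFn fun i : Fin (m + 1) =>
      Matrix.single (v ((τ i : ℕ) / 2)) (v (((τ i : ℕ) + 1) / 2)) (1 : K)).prod = 0 := by
  by_contra hne
  refine hτ (τ.eq_one_of_castSucc_lt_succ fun i => ?_)
  have hstep : v (((τ i.castSucc : ℕ) + 1) / 2) = v ((τ i.succ : ℕ) / 2) := by
    by_contra hvi
    exact hne (List.prod_ofFn_eq_zero_of_consecutive _ i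
      (Matrix.single_mul_single_of_ne _ _ _ _ hvi _))
  have h1 := (τ i.castSucc).isLt
  have h2 := (τ i.succ).isLt
  have heq := hv (by simp only [Set.mem_ofPred_eq]; omega)
    (by simp only [Set.mem_ofPred_eq]; omega) hstep
  have hinj : (τ i.castSucc : ℕ) ≠ τ i.succ := fun h =>
    (Fin.castSucc_lt_succ (i := i)).ne (τ.injective (Fin.ext h))
  rw [Fin.lt_def]
  omega

/-- The linear span of the image of a multilinear polynomial is stable under automorphisms. -/
theorem map_mem_span_multilinear_image {K R : Type*} [CommSemiring K] [Semiring R] [Algebra K R]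
    {m : ℕ} (a : Equiv.Perm (Fin m) → K) (φ : R →ₐ[K] R) {X : R}
    (hX : X ∈ Submodule.span K {N : R | ∃ A : Fin m → R,
      N = ∑ σ : Equiv.Perm (Fin m), a σ • (List.ofFn fun i => A (σ i)).prod}) :
    φ X ∈ Submodule.span K {N : R | ∃ A : Fin m → R,
      N = ∑ σ : Equiv.Perm (Fin m), a σ • (List.ofFn fun i => A (σ i)).prod} := by
  refine Submodule.span_induction (p := fun Y _ => φ Y ∈ _) ?_ ?_ ?_ ?_ hX
  · rintro _ ⟨A, rfl⟩
    refine Submodule.subset_span ⟨fun i => φ (A i), ?_⟩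
    simp [map_sum, map_list_prod, List.map_ofFn, Function.comp_def]
  · simp
  · intro x y _ _ hx hy
    rw [map_add]
    exact add_mem hx hy
  · intro c x _ hx
    rw [map_smul]
    exact Submodule.smul_mem _ c hx

/-- A subspace of matrices stable under automorphisms and containing one off-diagonal matrix unit
contains every matrix of trace zero. -/
theorem Matrix.mem_of_trace_eq_zero_of_single_mem {K ι : Type*} [Field K] [Fintype ι]
    [DecidableEq ι] (W : Submodule K (Matrix ι ι K))
    (hW : ∀ (φ : Matrix ι ι K →ₐ[K] Matrix ι ι K), ∀ X ∈ W, φ X ∈ W) {p q : ι} (hpq : p ≠ q)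
    (h : Matrix.single p q (1 : K) ∈ W) {M : Matrix ι ι K} (hM : M.trace = 0) : M ∈ W := by
  have hoff : ∀ i j : ι, i ≠ j → Matrix.single i j (1 : K) ∈ W := by
    intro i j hij
    let e : Equiv.Perm ι := Equiv.swap (Equiv.swap p i q) j * Equiv.swap p i
    have hp : e p = i := by
      have : i ≠ Equiv.swap p i q := fun hi => hpq <| (Equiv.swap p i).injective <| by
        rw [Equiv.swap_apply_left, ← hi]
      simp only [e, Equiv.Perm.mul_apply, Equiv.swap_apply_left]
      exact Equiv.swap_apply_of_ne_of_ne this hij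
    have hq : e q = j := by simp [e]
    have := hW (Matrix.reindexAlgEquiv K K e).toAlgHom _ h
    simpa [Matrix.coe_reindexAlgEquiv, hp, hq] using this
  have hdiag : ∀ i j : ι, Matrix.single i i (1 : K) - Matrix.single j j 1 ∈ W := by
    intro i j
    rcases eq_or_ne i j with rfl | hij
    · simp
    let u : (Matrix ι ι K)ˣ := ⟨Matrix.transvection j i 1, Matrix.transvection j i (-1),
      by simp [Matrix.transvection_mul_transvection_same _ _ hij.symm],
      by simp [Matrix.transvection_mul_transvection_same _ _ hij.symm]⟩
    have := hW (MulSemiringAction.toAlgHom K (Matrix ι ι K) (ConjAct.toConjAct u)) _ (hoff i j hij)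
    have hu : MulSemiringAction.toAlgHom K (Matrix ι ι K) (ConjAct.toConjAct u)
        (Matrix.single i j 1) = Matrix.single i j 1 + Matrix.single j j 1
          - Matrix.single i i 1 - Matrix.single j i 1 := by
      rw [MulSemiringAction.toAlgHom_apply, ConjAct.units_smul_def, ConjAct.ofConjAct_toConjAct]
      change Matrix.transvection j i 1 * Matrix.single i j 1 * Matrix.transvection j i (-1) = _
      have hneg : ∀ k l : ι, Matrix.single k l (-1 : K) = -Matrix.single k l 1 := fun k l =>
        map_neg (Matrix.singleAddMonoidHom k l) 1
      simp [Matrix.transvection, add_mul, mul_add, hneg]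
      abel
    rw [hu] at this
    have key := sub_mem (sub_mem (hoff i j hij) this) (hoff j i hij.symm)
    convert key using 1
    abel
  have hdecomp : M = ∑ i, ∑ j, M i j •
      (Matrix.single i j (1 : K) - if i = j then Matrix.single p p 1 else 0) := by
    simp only [smul_sub, Finset.sum_sub_distrib, smul_ite, smul_zero, Finset.sum_ite_eq,
      Finset.mem_univ, if_true, ← Finset.sum_smul]
    rw [show ∑ i, M i i = 0 from hM, zero_smul, sub_zero]
    conv_lhs => rw [Matrix.matrix_eq_sum_single M]
    simp [Matrix.smul_single]
  rw [hdecomp]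
  refine Submodule.sum_mem _ fun i _ => Submodule.sum_mem _ fun j _ => Submodule.smul_mem _ _ ?_
  split_ifs with hij
  · subst hij
    exact hdiag i p
  · rw [sub_zero]
    exact hoff i j hij

theorem span_of_image_contains_trace_zero (K : Type*) [Field K] (n m : ℕ) (hn : 2 ≤ n)
    (hm : 1 ≤ m) (hnm : m - 1 ≤ n) (a : Equiv.Perm (Fin m) → K) (ha : a ≠ 0)
    (M : Matrix (Fin n) (Fin n) K) (hM : Matrix.trace M = 0) :
    M ∈ Submodule.span K {N : Matrix (Fin n) (Fin n) K |
        ∃ A : Fin m → Matrix (Fin n) (Fin n) K,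
          N = ∑ σ : Equiv.Perm (Fin m), a σ • (List.ofFn fun i => A (σ i)).prod} := by
  obtain ⟨σ₀, hσ₀⟩ := Function.ne_iff.1 ha
  rw [Pi.zero_apply] at hσ₀
  obtain ⟨m, rfl⟩ : ∃ k, m = k + 1 := ⟨m - 1, by omega⟩
  rcases Nat.eq_zero_or_pos m with rfl | hmpos
  · refine Submodule.subset_span ⟨fun _ => (a σ₀)⁻¹ • M, ?_⟩
    have : Subsingleton (Fin (0 + 1)) := inferInstanceAs (Subsingleton (Fin 1))
    rw [Fintype.sum_subsingleton _ σ₀]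
    simp [smul_smul, hσ₀]
  let v : ℕ → Fin n := fun k => ⟨min k (n - 1), by omega⟩
  have hv : Set.InjOn v {k | 2 * k ≤ m + 1} := by
    intro k hk l hl hkl
    simp only [Set.mem_ofPred_eq] at hk hl
    simp only [v, Fin.mk.injEq] at hkl
    omega
  have hne : v (0 / 2) ≠ v ((m + 1) / 2) := by
    intro h
    have := hv (by simp) (by simp only [Set.mem_ofPred_eq]; omega) h
    omega
  refine Matrix.mem_of_trace_eq_zero_of_single_mem _
    (fun φ X hX => map_mem_span_multilinear_image a φ hX) hne ?_ hM
  rw [← Submodule.smul_mem_iff _ hσ₀]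
  refine Submodule.subset_span ⟨fun i => Matrix.single (v ((σ₀⁻¹ i : Fin (m + 1)) / 2))
    (v (((σ₀⁻¹ i : Fin (m + 1)) + 1) / 2)) 1, ?_⟩
  rw [Finset.sum_eq_single σ₀]
  · have hinv : ∀ i, σ₀⁻¹ (σ₀ i) = i := σ₀.symm_apply_apply
    simp only [hinv]
    rw [Matrix.prod_ofFn_single_walk (fun k => v (k / 2)) m]
  · intro σ _ hσ
    have hτ : σ₀⁻¹ * σ ≠ 1 := fun h => hσ (inv_mul_eq_one.1 h).symm
    have := Matrix.prod_ofFn_single_half_eq_zero (K := K) v hv _ hτ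
    simp only [Equiv.Perm.mul_apply] at this
    rw [this, smul_zero]
  · exact fun h => absurd (Finset.mem_univ _) h
end

section
/- Let K be a field, n ≥ 2 an integer, and A ∈ M_n(K) a diagonal matrix whose diagonal entries are pairwise distinct (A_{ii} ≠ A_{jj} for i ≠ j). Then the set {AX − XA | X ∈ M_n(K)} is exactly the set of matrices in M_n(K) whose main diagonal entries are all zero. -/
/-- The entries of the commutator of a diagonal matrix with `X`. -/
theorem Matrix.diagonal_mul_sub_mul_diagonal_apply {ι R : Type*} [Fintype ι] [DecidableEq ι]
    [CommRing R] (d : ι → R) (X : Matrix ι ι R) (i j : ι) :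
    (Matrix.diagonal d * X - X * Matrix.diagonal d) i j = (d i - d j) * X i j := by
  rw [Matrix.sub_apply, Matrix.diagonal_mul, Matrix.mul_diagonal]
  ring

theorem amitsur_rowen_commutator_with_distinct_diagonal (K : Type*) [Field K] (n : ℕ)
    (hn : 2 ≤ n) (A : Matrix (Fin n) (Fin n) K)
    (hdiag : ∀ i j : Fin n, i ≠ j → A i j = 0)
    (hdist : ∀ i j : Fin n, i ≠ j → A i i ≠ A j j) :
    {M : Matrix (Fin n) (Fin n) K | ∃ X : Matrix (Fin n) (Fin n) K, M = A * X - X * A} =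
      {M : Matrix (Fin n) (Fin n) K | ∀ i : Fin n, M i i = 0} := by
  have hA : Matrix.diagonal A.diag = A :=
    Matrix.IsDiag.diagonal_diag fun i j hij => hdiag i j hij
  have hcomm (X : Matrix (Fin n) (Fin n) K) (i j : Fin n) :
      (A * X - X * A) i j = (A i i - A j j) * X i j := by
    simpa only [hA, Matrix.diag_apply] using
      Matrix.diagonal_mul_sub_mul_diagonal_apply A.diag X i j
  ext M
  constructor
  · rintro ⟨X, rfl⟩ i
    rw [hcomm, sub_self, zero_mul]
  · intro hM
    refine ⟨Matrix.of fun i j => M i j / (A i i - A j j), ?_⟩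
    ext i j
    rw [hcomm, Matrix.of_apply]
    rcases eq_or_ne i j with rfl | hij
    · rw [hM i, sub_self, zero_mul]
    · rw [mul_div_cancel₀ _ (sub_ne_zero.mpr (hdist i j hij))]
end

section
/- Let n ≥ 2 be an integer, K a field with at least n elements (i.e., there is an injective map from {1,…,n} into K), and a, b, c, d, e, g ∈ K not all zero. Then for every matrix M ∈ M_n(K) with trace 0, there exist X, Y, Z ∈ M_n(K) such that M = aXYZ + bXZY + cYXZ + dYZX + eZXY + gZYX. -/
namespace Matrix

section Conjugation

variable {ι K : Type*} [Fintype ι] [DecidableEq ι]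

/-- The entries of the conjugate of `M` by the transvection that adds `t` times row `j` to
row `i`. -/
lemma exists_isConj_of_transvection [CommRing K] (M : Matrix ι ι K) {i j : ι} (hij : i ≠ j)
    (t : K) :
    ∃ N, IsConj M N ∧ (∀ k l, k ≠ i → l ≠ j → N k l = M k l) ∧
      (∀ l, l ≠ j → N i l = M i l + t * M j l) ∧
      (∀ k, k ≠ i → N k j = M k j - t * M k i) ∧
      N i j = M i j + t * M j j - t * (M i i + t * M j i) := by
  have h₁ : transvection i j t * transvection i j (-t) = 1 := by
    rw [transvection_mul_transvection_same _ _ hij, add_neg_cancel, transvection_zero]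
  have h₂ : transvection i j (-t) * transvection i j t = 1 := by
    rw [transvection_mul_transvection_same _ _ hij, neg_add_cancel, transvection_zero]
  refine ⟨transvection i j t * M * transvection i j (-t), ⟨⟨_, _, h₁, h₂⟩, ?_⟩, ?_, ?_, ?_, ?_⟩
  · change _ * _ = _ * _
    simp [mul_assoc, h₂]
  · intro k l hk hl
    rw [mul_transvection_apply_of_ne _ _ _ _ hl, transvection_mul_apply_of_ne _ _ _ _ hk]
  · intro l hl
    rw [mul_transvection_apply_of_ne _ _ _ _ hl, transvection_mul_apply_same]
  · intro k hk
    rw [mul_transvection_apply_same, transvection_mul_apply_of_ne _ _ _ _ hk,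
      transvection_mul_apply_of_ne _ _ _ _ hk]
    ring
  · rw [mul_transvection_apply_same, transvection_mul_apply_same, transvection_mul_apply_same]
    ring

lemma trace_eq_of_isConj [CommRing K] {M N : Matrix ι ι K} (h : IsConj M N) :
    trace M = trace N := by
  obtain ⟨u, hu⟩ := h
  have hN : N = u * M * (u⁻¹ : (Matrix ι ι K)ˣ) := (Units.eq_mul_inv_iff_mul_eq u).2 hu.eq.symm
  rw [hN, trace_units_conj]

variable [Field K]

lemma exists_isConj_diag_eq_zero_of_apply_ne_zero (U : Finset ι) :
    ∀ (M : Matrix ι ι K) (p q : ι), p ≠ q → p ∉ U → q ∉ U → M p q ≠ 0 → trace M = 0 →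
      (∀ k, k ∉ U → k ≠ p → k ≠ q → M k k = 0) → ∃ N, IsConj M N ∧ ∀ i, N i i = 0 := by
  induction U using Finset.induction_on with
  | empty =>
    intro M p q hpq _ _ hM htr hdiag
    obtain ⟨N, hMN, hN, hrow, -, -⟩ :=
      exists_isConj_of_transvection M hpq.symm (-(M q q / M p q))
    have hoff : ∀ k, k ≠ p → N k k = 0 := by
      intro k hkp
      by_cases hkq : k = q
      · subst hkq
        rw [hrow _ hkp]
        field_simp
        ring
      · rw [hN k k hkq hkp, hdiag k (Finset.notMem_empty k) hkp hkq]
    refine ⟨N, hMN, fun k => ?_⟩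
    by_cases hkp : k = p
    · have htrN := trace_eq_of_isConj hMN
      rw [htr, trace, Finset.sum_eq_single (f := N.diag) p (fun i _ hi => hoff i hi)
        (fun h => absurd (Finset.mem_univ p) h)] at htrN
      rw [hkp]
      exact htrN.symm
    · exact hoff k hkp
  | insert r U hrU ih =>
    intro M p q hpq hp hq hM htr hdiag
    simp only [Finset.mem_insert, not_or] at hp hq hdiag
    obtain ⟨hpr, hpU⟩ := hp
    obtain ⟨hqr, hqU⟩ := hq
    -- clear the entry `(r, q)`
    obtain ⟨A, hMA, hA, hArow, -, -⟩ :=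
      exists_isConj_of_transvection M (Ne.symm hpr) (-(M r q / M p q))
    have hApq : A p q = M p q := hA _ _ hpr hpq.symm
    have hArq : A r q = 0 := by
      rw [hArow _ hpq.symm]
      field_simp
      ring
    -- clear the entry `(q, q)`
    obtain ⟨B, hAB, hB, hBrow, -, -⟩ :=
      exists_isConj_of_transvection A hpq.symm (-(A q q / A p q))
    have hBpq : B p q ≠ 0 := by rwa [hB _ _ hpq hpq.symm, hApq]
    have hBrq : B r q = 0 := by rw [hB _ _ (Ne.symm hqr) hpq.symm, hArq]
    have hBqq : B q q = 0 := by
      rw [hBrow _ hpq.symm, hApq]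
      field_simp
      ring
    have hBdiag : ∀ k, k ∉ U → k ≠ p → k ≠ r → B k k = 0 := by
      intro k hkU hkp hkr
      by_cases hkq : k = q
      · rw [hkq, hBqq]
      · rw [hB _ _ hkq hkp, hA _ _ hkr hkp, hdiag k ⟨hkr, hkU⟩ hkp hkq]
    have hMB := hMA.trans hAB
    have htrB : trace B = 0 := (trace_eq_of_isConj hMB).symm.trans htr
    by_cases hBpr : B p r = 0
    · obtain ⟨C, hBC, hC, hCrow, hCcol, -⟩ := exists_isConj_of_transvection B hqr 1
      have hCpr : C p r ≠ 0 := by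
        rw [hCcol _ hpq, hBpr]
        simpa using hBpq
      obtain ⟨N, hCN, hN⟩ := ih C p r hpr hpU hrU hCpr
        ((trace_eq_of_isConj hBC).symm.trans htrB) (by
          intro k hkU hkp hkr
          by_cases hkq : k = q
          · rw [hkq, hCrow _ hqr, hBqq, hBrq]
            simp
          · rw [hC _ _ hkq hkr, hBdiag k hkU hkp hkr])
      exact ⟨N, (hMB.trans hBC).trans hCN, hN⟩
    · obtain ⟨N, hBN, hN⟩ := ih B p r hpr hpU hrU hBpr htrB hBdiag
      exact ⟨N, hMB.trans hBN, hN⟩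

/-- A trace zero matrix that is not scalar is similar to one with zero diagonal. -/
lemma exists_isConj_diag_eq_zero_or_eq_smul_one (M : Matrix ι ι K) (htr : trace M = 0) :
    (∃ N, IsConj M N ∧ ∀ i, N i i = 0) ∨ ∃ t : K, M = t • (1 : Matrix ι ι K) := by
  have key : ∀ (A : Matrix ι ι K) (p q : ι), p ≠ q → A p q ≠ 0 → trace A = 0 →
      ∃ N, IsConj A N ∧ ∀ i, N i i = 0 := fun A p q hpq hA hAtr =>
    exists_isConj_diag_eq_zero_of_apply_ne_zero (Finset.univ \ {p, q}) A p q hpq (by simp)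
      (by simp) hA hAtr (fun k hk hkp hkq => absurd hk (by simp [hkp, hkq]))
  by_cases hoff : ∃ p q, p ≠ q ∧ M p q ≠ 0
  · obtain ⟨p, q, hpq, hM⟩ := hoff
    exact Or.inl (key M p q hpq hM htr)
  push Not at hoff
  by_cases hd : ∃ p q, M p p ≠ M q q
  · obtain ⟨p, q, hM⟩ := hd
    have hpq : p ≠ q := fun hpq => hM (by rw [hpq])
    obtain ⟨A, hMA, -, -, -, hA⟩ := exists_isConj_of_transvection M hpq 1
    rw [hoff p q hpq, hoff q p hpq.symm] at hA
    obtain ⟨N, hAN, hN⟩ := key A p q hpq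
      (by rw [hA]; simpa [sub_eq_zero] using hM.symm) ((trace_eq_of_isConj hMA).symm.trans htr)
    exact Or.inl ⟨N, hMA.trans hAN, hN⟩
  · push Not at hd
    right
    rcases isEmpty_or_nonempty ι with _ | ⟨⟨i⟩⟩
    · exact ⟨0, Subsingleton.elim _ _⟩
    · refine ⟨M i i, ?_⟩
      ext k l
      by_cases hkl : k = l
      · subst hkl
        simp [hd k i]
      · simp [hkl, hoff k l hkl]

end Conjugation

section Shift

variable {K : Type*} {m : ℕ}

/-- The permutation matrix of the cyclic shift. -/
def cyclicShift (K : Type*) [Zero K] [One K] (m : ℕ) : Matrix (Fin (m + 2)) (Fin (m + 2)) K :=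
  of fun i j => if j = i + 1 then 1 else 0

/-- The inverse cyclic shift with weights `w`. -/
def weightedShift [Zero K] (w : Fin (m + 2) → K) : Matrix (Fin (m + 2)) (Fin (m + 2)) K :=
  of fun i j => if i = j + 1 then w j else 0

lemma cyclicShift_mul_diagonal_mul_weightedShift [CommRing K] (D w : Fin (m + 2) → K) :
    cyclicShift K m * diagonal D * weightedShift w = diagonal fun i => D (i + 1) * w i := by
  ext i k
  rw [mul_apply]
  simp only [mul_diagonal, cyclicShift, weightedShift, of_apply, diagonal_apply]
  rw [Finset.sum_eq_single (i + 1) (by simp +contextual) (by simp)]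
  by_cases h : i = k <;> simp [h]

lemma weightedShift_mul_diagonal_mul_cyclicShift [CommRing K] (D w : Fin (m + 2) → K) :
    weightedShift w * diagonal D * cyclicShift K m =
      diagonal fun i => D (i - 1) * w (i - 1) := by
  ext i k
  rw [mul_apply]
  simp only [mul_diagonal, cyclicShift, weightedShift, of_apply, diagonal_apply]
  rw [Finset.sum_eq_single (i - 1)]
  · by_cases h : i = k
    · simp [h, mul_comm]
    · simp [h, Ne.symm h]
  · intro j _ hj
    rw [if_neg (fun h => hj (by rw [h, add_sub_cancel_right])), zero_mul, zero_mul]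
  · simp

lemma cyclicShift_mul_weightedShift [CommRing K] (w : Fin (m + 2) → K) :
    cyclicShift K m * weightedShift w = diagonal w := by
  simpa using cyclicShift_mul_diagonal_mul_weightedShift (fun _ => (1 : K)) w

lemma weightedShift_mul_cyclicShift [CommRing K] (w : Fin (m + 2) → K) :
    weightedShift w * cyclicShift K m = diagonal fun i => w (i - 1) := by
  simpa using weightedShift_mul_diagonal_mul_cyclicShift (fun _ => (1 : K)) w

lemma exists_sub_shift_eq [CommRing K] (t : K)
    (ht : trace (t • (1 : Matrix (Fin (m + 2)) (Fin (m + 2)) K)) = 0) :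
    ∃ s : Fin (m + 2) → K, ∀ i, s i - s (i - 1) = t := by
  refine ⟨fun i => ((i : ℕ) + 1) * t, fun i => ?_⟩
  obtain ⟨j, rfl⟩ : ∃ j, i = j + 1 := ⟨i - 1, (sub_add_cancel i 1).symm⟩
  rw [add_sub_cancel_right]
  simp only [Fin.val_add_one]
  split_ifs with h
  · simp only [trace_smul, trace_one, Fintype.card_fin, smul_eq_mul] at ht
    push_cast at ht
    simp only [h, Fin.val_last]
    push_cast
    linear_combination -ht
  · push_cast
    ring

end Shift

section Image

variable {K : Type*} [Field K] {m : ℕ}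

/-- The value at `(X, Y, Z)` of the general multilinear polynomial of degree three. -/
def cubicEval {R : Type*} [Ring R] [Algebra K R] (a b c d e g : K) (X Y Z : R) : R :=
  a • (X * Y * Z) + b • (X * Z * Y) + c • (Y * X * Z) + d • (Y * Z * X) +
    e • (Z * X * Y) + g • (Z * Y * X)

lemma exists_eq_cubicEval_of_isConj {R : Type*} [Ring R] [Algebra K R] {a b c d e g : K}
    {M N : R} (h : IsConj M N) (hN : ∃ X Y Z, N = cubicEval a b c d e g X Y Z) :
    ∃ X Y Z, M = cubicEval a b c d e g X Y Z := by
  obtain ⟨u, hu⟩ := h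
  obtain ⟨X, Y, Z, rfl⟩ := hN
  refine ⟨↑u⁻¹ * X * u, ↑u⁻¹ * Y * u, ↑u⁻¹ * Z * u, ?_⟩
  rw [← Units.inv_mul_cancel_left u M, hu.eq]
  simp [cubicEval, mul_add, add_mul, mul_assoc]

lemma exists_eq_commutator_of_isConj {R : Type*} [Ring R] {M N : R} (h : IsConj M N)
    (hN : ∃ X Y, N = X * Y - Y * X) : ∃ X Y, M = X * Y - Y * X := by
  obtain ⟨u, hu⟩ := h
  obtain ⟨X, Y, rfl⟩ := hN
  refine ⟨↑u⁻¹ * X * u, ↑u⁻¹ * Y * u, ?_⟩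
  rw [← Units.inv_mul_cancel_left u M, hu.eq]
  simp [mul_sub, sub_mul, mul_assoc]

/-- A trace zero matrix is a commutator. -/
lemma exists_eq_commutator {D : Fin (m + 2) → K} (hD : Function.Injective D)
    (M : Matrix (Fin (m + 2)) (Fin (m + 2)) K) (hM : trace M = 0) :
    ∃ X Y : Matrix (Fin (m + 2)) (Fin (m + 2)) K, M = X * Y - Y * X := by
  rcases exists_isConj_diag_eq_zero_or_eq_smul_one M hM with ⟨N, hMN, hN⟩ | ⟨t, rfl⟩
  · refine exists_eq_commutator_of_isConj hMN
      ⟨diagonal D, of fun i j => N i j / (D i - D j), ?_⟩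
    ext i j
    rw [sub_apply, diagonal_mul, mul_diagonal, of_apply]
    by_cases hij : i = j
    · subst hij
      simp [hN]
    · have := sub_ne_zero.2 (hD.ne hij)
      field_simp
  · obtain ⟨s, hs⟩ := exists_sub_shift_eq t hM
    refine ⟨cyclicShift K m, weightedShift s, ?_⟩
    rw [cyclicShift_mul_weightedShift, weightedShift_mul_cyclicShift, diagonal_sub,
      smul_one_eq_diagonal]
    simp only [hs]

lemma exists_eq_cubicEval_of_add_eq_zero {D : Fin (m + 2) → K} (hD : Function.Injective D)
    {a b c : K} (ha : a ≠ 0) (habc : a + b + c = 0)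
    (M : Matrix (Fin (m + 2)) (Fin (m + 2)) K) (hM : trace M = 0) :
    ∃ X Y Z, M = cubicEval a b c b c a X Y Z := by
  obtain rfl : c = -a - b := by linear_combination habc
  rcases exists_isConj_diag_eq_zero_or_eq_smul_one M hM with ⟨N, hMN, hN⟩ | ⟨t, rfl⟩
  · refine exists_eq_cubicEval_of_isConj hMN
      ⟨diagonal D, of fun i j => -N i j / (a * (D i - D j) ^ 2), diagonal D, ?_⟩
    ext i j
    simp only [cubicEval, mul_assoc, add_apply, smul_apply, diagonal_mul, mul_diagonal,
      diagonal_mul_diagonal, of_apply, smul_eq_mul]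
    by_cases hij : i = j
    · subst hij
      simp [hN]
    · have := sub_ne_zero.2 (hD.ne hij)
      field_simp
      ring
  · obtain ⟨s, hs⟩ := exists_sub_shift_eq t hM
    obtain ⟨w, hw⟩ : ∃ w : Fin (m + 2) → K, ∀ i, a * (D (i + 1) - D i) * w i = s i := by
      refine ⟨fun i => s i / (a * (D (i + 1) - D i)), fun i => mul_div_cancel₀ _ ?_⟩
      exact mul_ne_zero ha (sub_ne_zero.2 (hD.ne (by simp)))
    refine ⟨cyclicShift K m, diagonal D, weightedShift w, ?_⟩
    simp only [cubicEval, cyclicShift_mul_diagonal_mul_weightedShift,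
      weightedShift_mul_diagonal_mul_cyclicShift, cyclicShift_mul_weightedShift,
      weightedShift_mul_cyclicShift, mul_assoc (diagonal D), diagonal_mul_diagonal,
      ← diagonal_smul, diagonal_add, smul_one_eq_diagonal]
    congr 1
    ext i
    have h₁ := hw i
    have h₂ := hw (i - 1)
    rw [sub_add_cancel] at h₂
    simp only [Pi.smul_apply, smul_eq_mul]
    linear_combination -hs i - h₁ + h₂

end Image

end Matrix


theorem degree_three_image_contains_trace_zero (K : Type*) [Field K] (n : ℕ) (hn : 2 ≤ n)
    (hK : ∃ f : Fin n → K, Function.Injective f) (a b c d e g : K)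
    (h : ¬ (a = 0 ∧ b = 0 ∧ c = 0 ∧ d = 0 ∧ e = 0 ∧ g = 0))
    (M : Matrix (Fin n) (Fin n) K) (hM : Matrix.trace M = 0) :
    ∃ X Y Z : Matrix (Fin n) (Fin n) K,
      M = a • (X * Y * Z) + b • (X * Z * Y) + c • (Y * X * Z) + d • (Y * Z * X) +
        e • (Z * X * Y) + g • (Z * Y * X) := by
  obtain ⟨m, rfl⟩ := Nat.exists_eq_add_of_le' hn
  obtain ⟨D, hD⟩ := hK
  change ∃ X Y Z, M = Matrix.cubicEval a b c d e g X Y Z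
  by_cases hsum : a + b + c + d + e + g = 0
  swap
  · refine ⟨(a + b + c + d + e + g)⁻¹ • M, 1, 1, ?_⟩
    simp only [Matrix.cubicEval, mul_one, one_mul, ← add_smul]
    rw [smul_inv_smul₀ hsum]
  have hcomm (t : K) (ht : t ≠ 0) :
      ∃ X Y : Matrix (Fin (m + 2)) (Fin (m + 2)) K, M = t • (X * Y) - t • (Y * X) := by
    obtain ⟨X, Y, hXY⟩ := Matrix.exists_eq_commutator hD (t⁻¹ • M) (by simp [hM])
    exact ⟨X, Y, by rw [← smul_sub, ← hXY, smul_inv_smul₀ ht]⟩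
  by_cases hz : a + b + e = 0
  swap
  · obtain ⟨X, Y, rfl⟩ := hcomm _ hz
    refine ⟨X, Y, 1, ?_⟩
    obtain rfl : g = -(a + b + e) - c - d := by linear_combination hsum
    simp only [Matrix.cubicEval, mul_one, one_mul]
    module
  by_cases hy : a + b + c = 0
  swap
  · obtain ⟨X, Z, rfl⟩ := hcomm _ hy
    refine ⟨X, 1, Z, ?_⟩
    obtain rfl : g = -(a + b + c) - d - e := by linear_combination hsum
    simp only [Matrix.cubicEval, mul_one, one_mul]
    module
  by_cases hx : a + c + d = 0
  swap
  · obtain ⟨Y, Z, rfl⟩ := hcomm _ hx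
    refine ⟨1, Y, Z, ?_⟩
    obtain rfl : g = -(a + c + d) - b - e := by linear_combination hsum
    simp only [Matrix.cubicEval, mul_one, one_mul]
    module
  obtain rfl : e = c := by linear_combination hz - hy
  obtain rfl : d = b := by linear_combination hx - hy
  obtain rfl : g = a := by linear_combination hsum - hz - hx
  by_cases ha : g = 0
  swap
  · exact Matrix.exists_eq_cubicEval_of_add_eq_zero hD ha hy M hM
  by_cases hb : d = 0
  swap
  · obtain ⟨X, Z, Y, rfl⟩ := Matrix.exists_eq_cubicEval_of_add_eq_zero (b := g) (c := e) hD hb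
      (by linear_combination hy) M hM
    refine ⟨X, Y, Z, ?_⟩
    simp only [Matrix.cubicEval]
    abel
  exact absurd ⟨ha, hb, by linear_combination hy - ha - hb, hb,
    by linear_combination hy - ha - hb, ha⟩ h
end

section
/- Let n ≥ 2 be an integer, K a field, and a, b, c, d, e, g ∈ K. Then every matrix of the form aXYZ + bXZY + cYXZ + dYZX + eZXY + gZYX with X, Y, Z ∈ M_n(K) has trace 0 if and only if a + b + c + d + e + g = 0 and a + d + e = 0. -/
/-- By cyclicity, the trace of a value of a multilinear polynomial of degree three depends only on
the traces of `X * Y * Z` and `X * Z * Y`. -/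
theorem trace_degree_three_eq {K m : Type*} [CommRing K] [Fintype m] (a b c d e g : K)
    (X Y Z : Matrix m m K) :
    Matrix.trace (a • (X * Y * Z) + b • (X * Z * Y) + c • (Y * X * Z) + d • (Y * Z * X) +
        e • (Z * X * Y) + g • (Z * Y * X)) =
      (a + d + e) * Matrix.trace (X * Y * Z) + (b + c + g) * Matrix.trace (X * Z * Y) := by
  simp only [Matrix.trace_add, Matrix.trace_smul, smul_eq_mul]
  have h₁ := Matrix.trace_mul_cycle X Z Y
  have h₂ := Matrix.trace_mul_cycle Y X Z
  have h₃ := Matrix.trace_mul_cycle X Y Z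
  have h₄ := Matrix.trace_mul_cycle Z X Y
  linear_combination (-c - g) * h₁ - g * h₂ - (d + e) * h₃ - d * h₄

theorem degree_three_image_in_trace_zero_iff (K : Type*) [Field K] (n : ℕ) (hn : 2 ≤ n)
    (a b c d e g : K) :
    (∀ X Y Z : Matrix (Fin n) (Fin n) K,
        Matrix.trace (a • (X * Y * Z) + b • (X * Z * Y) + c • (Y * X * Z) + d • (Y * Z * X) +
          e • (Z * X * Y) + g • (Z * Y * X)) = 0) ↔
      (a + b + c + d + e + g = 0 ∧ a + d + e = 0) := by
  simp only [trace_degree_three_eq]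
  constructor
  · intro h
    have : Nontrivial (Fin n) := Fin.nontrivial_iff_two_le.mpr hn
    obtain ⟨i, j, hij⟩ := exists_pair_ne (Fin n)
    have h₁ : a + d + e = 0 := by
      simpa [hij] using h (Matrix.single i i 1) (Matrix.single i j 1) (Matrix.single j i 1)
    have h₂ : a + d + e + (b + c + g) = 0 := by
      simpa using h (Matrix.single i i 1) (Matrix.single i i 1) (Matrix.single i i 1)
    exact ⟨by linear_combination h₂, h₁⟩
  · rintro ⟨h₁, h₂⟩ X Y Z
    have h₃ : b + c + g = 0 := by linear_combination h₁ - h₂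
    simp [h₂, h₃]
end

section
/- Let n ≥ 2 be an integer, K a field with at least n elements (i.e., there is an injective map from {1,…,n} into K), and a, b, c, d, e, g ∈ K not all zero. Then the set {aXYZ + bXZY + cYXZ + dYZX + eZXY + gZYX | X, Y, Z ∈ M_n(K)} equals the set of trace-zero matrices in M_n(K) if and only if a + b + c + d + e + g = 0 and a + d + e = 0. -/
attribute [local instance] LieRing.ofAssociativeRing

section ZeroDiagonal

variable {K ι : Type*} [Field K] [Fintype ι] [DecidableEq ι]

/-- Conjugation by the transvection `1 + t E_ij`, entrywise. -/
lemma Matrix.exists_isConj_transvection (A : Matrix ι ι K) {i j : ι} (hij : i ≠ j) (t : K) :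
    ∃ B, IsConj A B ∧ ∀ k l, B k l = A k l + (if k = i then t * A j l else 0) -
      (if l = j then t * (A k i + if k = i then t * A j i else 0) else 0) := by
  have h1 : transvection i j t * transvection i j (-t) = 1 := by
    rw [transvection_mul_transvection_same _ _ hij, add_neg_cancel, transvection_zero]
  have h2 : transvection i j (-t) * transvection i j t = 1 := by
    rw [transvection_mul_transvection_same _ _ hij, neg_add_cancel, transvection_zero]
  refine ⟨transvection i j t * A * transvection i j (-t),
    ⟨⟨transvection i j t, transvection i j (-t), h1, h2⟩, ?_⟩, fun k l => ?_⟩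
  · rw [SemiconjBy, mul_assoc _ (transvection i j (-t)), h2, mul_one]
  have hrow : ∀ m, (transvection i j t * A) k m = A k m + if k = i then t * A j m else 0 := by
    intro m
    split_ifs with hk
    · subst hk; simp
    · simp [hk]
  split_ifs with hk hl hl
  · subst hl; rw [mul_transvection_apply_same, hrow, hrow]; simp [hk]; ring
  · rw [mul_transvection_apply_of_ne _ _ _ _ hl, hrow]; simp [hk]
  · subst hl; rw [mul_transvection_apply_same, hrow, hrow]; simp [hk]; ring
  · rw [mul_transvection_apply_of_ne _ _ _ _ hl, hrow]; simp [hk]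

/-- The diagonal entries indexed by `S` can be cleared by a conjugation that leaves the other
diagonal entries alone. -/
lemma Matrix.exists_isConj_diag_eq_zero_on (S : Finset ι) (A : Matrix ι ι K)
    (htr : ∑ k ∈ S, A k k = 0)
    (hA : (∃ i ∈ S, ∃ j ∈ S, i ≠ j ∧ A j i ≠ 0) ∨ ∀ k ∈ S, A k k = 0) :
    ∃ B, IsConj A B ∧ (∀ k ∈ S, B k k = 0) ∧ ∀ k ∉ S, B k k = A k k := by
  induction S using Finset.strongInduction generalizing A with
  | H S ih =>
  rcases hA with ⟨i, hi, j, hj, hij, hji⟩ | h0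
  swap
  · exact ⟨A, IsConj.refl A, h0, fun _ _ => rfl⟩
  obtain ⟨B, hAB, hB⟩ := A.exists_isConj_transvection hij (-(A i i / A j i))
  have hBii : B i i = 0 := by simp [hB, hij]; field_simp; ring
  have hBji : B j i ≠ 0 := by simpa [hB, hij, hij.symm] using hji
  have hBdiag : ∀ k, k ∉ S → B k k = A k k := fun k hk => by
    have h1 : k ≠ i := fun h => hk (h ▸ hi)
    have h2 : k ≠ j := fun h => hk (h ▸ hj)
    simp [hB, h1, h2]
  have hBtr : ∑ k ∈ S, B k k = 0 := by
    have : ∀ k, B k k = A k k + (if k = i then -(A i i / A j i) * A j i else 0) -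
        (if k = j then -(A i i / A j i) * A j i else 0) := fun k => by
      rw [hB]
      by_cases h1 : k = i
      · subst h1; simp [hij]
      · by_cases h2 : k = j
        · subst h2; simp [h1]
        · simp [h1, h2]
    simp [this, Finset.sum_add_distrib, htr, hi, hj]
  have hBtr' : ∑ k ∈ S.erase i, B k k = 0 := by
    rw [← hBtr, ← Finset.add_sum_erase S _ hi, hBii, zero_add]
  have key : ∀ C, IsConj B C → C i i = 0 → (∀ k, k ≠ i → C k k = B k k) →
      ((∃ i' ∈ S.erase i, ∃ j ∈ S.erase i, i' ≠ j ∧ C j i' ≠ 0) ∨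
        ∀ k ∈ S.erase i, C k k = 0) →
      ∃ B, IsConj A B ∧ (∀ k ∈ S, B k k = 0) ∧ ∀ k ∉ S, B k k = A k k := by
    intro C hBC hCii hCdiag hC
    obtain ⟨E, hCE, hE0, hE⟩ := ih _ (Finset.erase_ssubset hi) C
      ((Finset.sum_congr rfl fun k hk => hCdiag k (Finset.ne_of_mem_erase hk)).trans hBtr') hC
    refine ⟨E, (hAB.trans hBC).trans hCE, fun k hk => ?_, fun k hk => ?_⟩
    · by_cases hki : k = i
      · subst hki; rw [hE _ (Finset.notMem_erase _ _), hCii]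
      · exact hE0 k (Finset.mem_erase.2 ⟨hki, hk⟩)
    · have hki : k ≠ i := fun h => hk (h ▸ hi)
      rw [hE k fun h => hk (Finset.mem_of_mem_erase h), hCdiag k hki, hBdiag k hk]
  by_cases hoff : (∃ i' ∈ S.erase i, ∃ j ∈ S.erase i, i' ≠ j ∧ B j i' ≠ 0) ∨
      ∀ k ∈ S.erase i, B k k = 0
  · exact key B (IsConj.refl B) hBii (fun _ _ => rfl) hoff
  push Not at hoff
  obtain ⟨hoff, m, hm, hmm⟩ := hoff
  have hjT : j ∈ S.erase i := Finset.mem_erase.2 ⟨hij.symm, hj⟩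
  obtain ⟨k, hkT, hkj⟩ : ∃ k ∈ S.erase i, k ≠ j := by
    by_contra! hall
    rw [Finset.sum_eq_single_of_mem j hjT fun b hb hbj => absurd (hall b hb) hbj] at hBtr'
    exact hmm (hall m hm ▸ hBtr')
  have hki : k ≠ i := Finset.ne_of_mem_erase hkT
  have hjk : B j k = 0 := hoff k hkT j hjT hkj
  obtain ⟨C, hBC, hC⟩ := B.exists_isConj_transvection hkj (-(B k i / B j i))
  have hCki : C k i = 0 := by simp [hC, hij]; field_simp; ring
  have hCdiag : ∀ l, C l l = B l l := fun l => by
    by_cases h1 : l = k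
    · subst h1; simp [hC, hkj, hjk]
    · by_cases h2 : l = j
      · subst h2; simp [hC, h1, hjk]
      · simp [hC, h1, h2]
  have hCji : C j i = B j i := by simp [hC, hij, hkj.symm]
  have hCjk : C j k = 0 := by simp [hC, hkj, hkj.symm, hjk]
  obtain ⟨E, hCE, hE⟩ := C.exists_isConj_transvection hki.symm 1
  have hEdiag : ∀ l, E l l = B l l := fun l => by
    rw [← hCdiag l]
    by_cases h1 : l = i
    · subst h1; simp [hE, hki.symm, hCki]
    · by_cases h2 : l = k
      · subst h2; simp [hE, h1, hCki]
      · simp [hE, h1, h2]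
  refine key E (hBC.trans hCE) ((hEdiag i).trans hBii) (fun l _ => hEdiag l)
    (Or.inl ⟨k, hkT, j, hjT, hkj, ?_⟩)
  simpa [hE, hij.symm, hCjk, hCji] using hBji

lemma Matrix.exists_isConj_diag_eq_zero (A : Matrix ι ι K) (htr : A.trace = 0)
    (hA : ∀ r : K, A ≠ r • (1 : Matrix ι ι K)) : ∃ B, IsConj A B ∧ ∀ k, B k k = 0 := by
  by_cases hoff : ∃ i j, i ≠ j ∧ A j i ≠ 0
  · obtain ⟨i, j, hij, hji⟩ := hoff
    obtain ⟨B, hAB, hB, -⟩ := A.exists_isConj_diag_eq_zero_on Finset.univ htr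
      (Or.inl ⟨i, Finset.mem_univ _, j, Finset.mem_univ _, hij, hji⟩)
    exact ⟨B, hAB, fun k => hB k (Finset.mem_univ k)⟩
  push Not at hoff
  obtain ⟨i, j, hd⟩ : ∃ i j, A i i ≠ A j j := by
    by_contra! hall
    rcases isEmpty_or_nonempty ι with hι | ⟨⟨i₀⟩⟩
    · exact hA 0 (Subsingleton.elim _ _)
    · refine hA (A i₀ i₀) (Matrix.ext fun k l => ?_)
      by_cases hkl : k = l
      · subst hkl; simpa using hall k i₀
      · simpa [hkl] using hoff l k (Ne.symm hkl)
  have hij : i ≠ j := fun h => hd (h ▸ rfl)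
  obtain ⟨B, hAB, hB⟩ := A.exists_isConj_transvection hij 1
  have hBij : B i j ≠ 0 := by
    simp only [hB, if_true, hoff j i hij.symm, hoff i j hij]
    intro h
    apply hd
    linear_combination -h
  have hBtr : B.trace = 0 := by
    obtain ⟨u, hu⟩ := hAB
    rw [← (Units.mul_inv_eq_iff_eq_mul u).2 hu.eq, Matrix.trace_mul_cycle, Units.inv_mul, one_mul, htr]
  obtain ⟨E, hBE, hE, -⟩ := B.exists_isConj_diag_eq_zero_on Finset.univ hBtr
    (Or.inl ⟨j, Finset.mem_univ _, i, Finset.mem_univ _, hij.symm, hBij⟩)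
  exact ⟨E, hAB.trans hBE, fun k => hE k (Finset.mem_univ k)⟩

/-- `ad D` is surjective on zero-diagonal matrices when `D` is diagonal with distinct entries. -/
lemma Matrix.exists_lie_diagonal_eq {v : ι → K} (hv : Function.Injective v) (N : Matrix ι ι K)
    (hN : ∀ k, N k k = 0) :
    ∃ Z : Matrix ι ι K, (∀ k, Z k k = 0) ∧ ⁅diagonal v, Z⁆ = N := by
  refine ⟨of fun i j => N i j / (v i - v j), fun k => by simp, Matrix.ext fun i j => ?_⟩
  rw [Ring.lie_def, sub_apply, diagonal_mul, mul_diagonal, of_apply]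
  by_cases hij : i = j
  · subst hij; simp [hN]
  · have : v i - v j ≠ 0 := sub_ne_zero.2 fun h => hij (hv h)
    field_simp

end ZeroDiagonal

/-- The Weyl relation has a solution in `n × n` matrices when the characteristic divides `n`. -/
lemma Matrix.exists_lie_eq_one {K : Type*} [Field K] {n : ℕ} (hn : (n : K) = 0) :
    ∃ P Q : Matrix (Fin n) (Fin n) K, ⁅P, Q⁆ = 1 := by
  refine ⟨of fun i j => if (i : ℕ) + 1 = j then (j : K) else 0,
    of fun i j => if (i : ℕ) = j + 1 then 1 else 0, Matrix.ext fun i k => ?_⟩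
  have hPQ : ∑ j : Fin n, (if (i : ℕ) + 1 = j then ((j : ℕ) : K) else 0) *
      (if (j : ℕ) = k + 1 then 1 else 0) = if i = k then (i : K) + 1 else 0 := by
    by_cases hi : (i : ℕ) + 1 < n
    · rw [Finset.sum_eq_single_of_mem ⟨(i : ℕ) + 1, hi⟩ (Finset.mem_univ _)]
      · simp [Fin.ext_iff]
      · intro b _ hb
        rw [if_neg fun h => hb (Fin.ext h.symm), zero_mul]
    · have hin : (i : ℕ) + 1 = n := by omega
      have h0 : (i : K) + 1 = 0 := by rw [← hn]; exact_mod_cast congrArg _ hin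
      rw [h0, ite_self]
      refine Finset.sum_eq_zero fun j _ => ?_
      rw [if_neg (by omega), zero_mul]
  have hQP : ∑ j : Fin n, (if (i : ℕ) = j + 1 then (1 : K) else 0) *
      (if (j : ℕ) + 1 = k then ((k : ℕ) : K) else 0) = if i = k then (i : K) else 0 := by
    by_cases hi : (i : ℕ) = 0
    · rw [hi, Nat.cast_zero, ite_self]
      refine Finset.sum_eq_zero fun j _ => ?_
      rw [if_neg (by omega), zero_mul]
    · rw [Finset.sum_eq_single_of_mem ⟨(i : ℕ) - 1, by omega⟩ (Finset.mem_univ _)]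
      · have : (i : ℕ) - 1 + 1 = i := by omega
        by_cases hik : i = k
        · subst hik; simp [this]
        · simp [this, hik, Fin.val_inj]
      · intro b _ hb
        rw [if_neg fun h => hb (Fin.ext (by simp [h])), zero_mul]
  rw [Ring.lie_def, sub_apply, mul_apply, mul_apply]
  simp only [of_apply]
  rw [hPQ, hQP, one_apply]
  split_ifs <;> ring

lemma Matrix.exists_lie_lie_eq_of_trace_eq_zero {K : Type*} [Field K] {n : ℕ} {v : Fin n → K}
    (hv : Function.Injective v) (M : Matrix (Fin n) (Fin n) K) (hM : M.trace = 0) :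
    ∃ X Y Z : Matrix (Fin n) (Fin n) K, ⁅X, ⁅Y, Z⁆⁆ = M ∧ ⁅Y, ⁅X, Z⁆⁆ = 0 := by
  by_cases hs : ∃ r : K, M = r • (1 : Matrix (Fin n) (Fin n) K)
  · obtain ⟨r, rfl⟩ := hs
    rcases eq_or_ne r 0 with rfl | hr
    · exact ⟨0, 0, 0, by simp⟩
    have hn : (n : K) = 0 := by simpa [hr] using hM
    obtain ⟨P, Q, hPQ⟩ := Matrix.exists_lie_eq_one hn
    have hPQQ : ⁅P * Q, Q⁆ = Q := by
      rw [Ring.lie_def] at hPQ ⊢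
      rw [← mul_assoc Q, ← sub_mul, hPQ, one_mul]
    refine ⟨P, r • (P * Q), Q, ?_, ?_⟩
    · rw [smul_lie, hPQQ, lie_smul, hPQ]
    · rw [hPQ, Ring.lie_def, mul_one, one_mul, sub_self]
  · push Not at hs
    obtain ⟨N, hMN, hN⟩ := M.exists_isConj_diag_eq_zero hM hs
    obtain ⟨u, hMN⟩ := hMN.symm
    have hu := (Units.mul_inv_eq_iff_eq_mul u).2 hMN.eq
    obtain ⟨W, hW, hDW⟩ := Matrix.exists_lie_diagonal_eq hv N hN
    obtain ⟨Z, -, hDZ⟩ := Matrix.exists_lie_diagonal_eq hv W hW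
    have hconj : ∀ A B : Matrix (Fin n) (Fin n) K,
        ⁅(u : Matrix (Fin n) (Fin n) K) * A * (u⁻¹ : (Matrix (Fin n) (Fin n) K)ˣ),
          (u : Matrix (Fin n) (Fin n) K) * B * (u⁻¹ : (Matrix (Fin n) (Fin n) K)ˣ)⁆ =
        (u : Matrix (Fin n) (Fin n) K) * ⁅A, B⁆ * (u⁻¹ : (Matrix (Fin n) (Fin n) K)ˣ) := by
      intro A B
      simp only [Ring.lie_def, mul_sub, sub_mul, mul_assoc, Units.inv_mul_cancel_left]
    refine ⟨u * diagonal v * (u⁻¹ : (Matrix (Fin n) (Fin n) K)ˣ),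
      u * (-Z) * (u⁻¹ : (Matrix (Fin n) (Fin n) K)ˣ),
      u * diagonal v * (u⁻¹ : (Matrix (Fin n) (Fin n) K)ˣ), ?_, ?_⟩
    · rw [hconj, hconj, neg_lie, lie_skew, hDZ, hDW, hu]
    · rw [lie_self, lie_zero]

theorem degree_three_image_eq_trace_zero_iff (K : Type*) [Field K] (n : ℕ) (hn : 2 ≤ n)
    (hK : ∃ f : Fin n → K, Function.Injective f) (a b c d e g : K)
    (h : ¬ (a = 0 ∧ b = 0 ∧ c = 0 ∧ d = 0 ∧ e = 0 ∧ g = 0)) :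
    ({M : Matrix (Fin n) (Fin n) K | ∃ X Y Z : Matrix (Fin n) (Fin n) K,
        M = a • (X * Y * Z) + b • (X * Z * Y) + c • (Y * X * Z) + d • (Y * Z * X) +
          e • (Z * X * Y) + g • (Z * Y * X)} =
      {M : Matrix (Fin n) (Fin n) K | Matrix.trace M = 0}) ↔
      (a + b + c + d + e + g = 0 ∧ a + d + e = 0) := by
  have htrace : ∀ X Y Z : Matrix (Fin n) (Fin n) K,
      (a • (X * Y * Z) + b • (X * Z * Y) + c • (Y * X * Z) + d • (Y * Z * X) +
          e • (Z * X * Y) + g • (Z * Y * X)).trace =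
        (a + d + e) * (X * Y * Z).trace + (b + c + g) * (X * Z * Y).trace := by
    intro X Y Z
    simp only [Matrix.trace_add, Matrix.trace_smul, smul_eq_mul]
    rw [← Matrix.trace_mul_cycle X Y Z, Matrix.trace_mul_cycle Y Z X,
      ← Matrix.trace_mul_cycle X Z Y, Matrix.trace_mul_cycle Z Y X]
    ring
  constructor
  · intro himage
    have h0 : ∀ X Y Z : Matrix (Fin n) (Fin n) K,
        (a + d + e) * (X * Y * Z).trace + (b + c + g) * (X * Z * Y).trace = 0 := by
      intro X Y Z
      rw [← htrace]
      exact himage.subset ⟨X, Y, Z, rfl⟩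
    let i : Fin n := ⟨0, by omega⟩
    let j : Fin n := ⟨1, by omega⟩
    have hij : i ≠ j := by simp [i, j]
    have h1 := h0 (Matrix.single i i 1) (Matrix.single i i 1) (Matrix.single i i 1)
    have h2 := h0 (Matrix.single i j 1) (Matrix.single j i 1) (Matrix.single i i 1)
    simp [hij.symm] at h1 h2
    exact ⟨by linear_combination h1, h2⟩
  · rintro ⟨hsum, hA3⟩
    have hg : g = -(b + c) := by linear_combination hsum - hA3
    have he : e = -(a + d) := by linear_combination hA3
    obtain ⟨v, hv⟩ := hK
    refine Set.Subset.antisymm ?_ fun M hM => ?_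
    · rintro _ ⟨X, Y, Z, rfl⟩
      rw [Set.mem_ofPred_eq, htrace, hA3, hg]
      ring
    obtain ⟨X, Y, Z, hXYZ, hYXZ⟩ := Matrix.exists_lie_lie_eq_of_trace_eq_zero hv M hM
    by_cases hX : a + c + d = 0
    swap
    · refine ⟨1, (a + c + d)⁻¹ • X, ⁅Y, Z⁆, ?_⟩
      have : M = (a + c + d) • (a + c + d)⁻¹ • M := by rw [smul_inv_smul₀ hX]
      rw [this, ← hXYZ, Ring.lie_def X, hg, he]
      simp only [one_mul, mul_one, smul_mul_assoc, mul_smul_comm]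
      module
    by_cases hY : a + b + c = 0
    swap
    · refine ⟨(a + b + c)⁻¹ • X, 1, ⁅Y, Z⁆, ?_⟩
      have : M = (a + b + c) • (a + b + c)⁻¹ • M := by rw [smul_inv_smul₀ hY]
      rw [this, ← hXYZ, Ring.lie_def X, hg, he]
      simp only [one_mul, mul_one, smul_mul_assoc, mul_smul_comm]
      module
    by_cases hZ : a + b + e = 0
    swap
    · refine ⟨(a + b + e)⁻¹ • X, ⁅Y, Z⁆, 1, ?_⟩
      have : M = (a + b + e) • (a + b + e)⁻¹ • M := by rw [smul_inv_smul₀ hZ]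
      rw [this, ← hXYZ, Ring.lie_def X, hg, he]
      simp only [one_mul, mul_one, smul_mul_assoc, mul_smul_comm]
      module
    have hb : b = -(a + c) := by linear_combination hY
    have hd : d = -(a + c) := by linear_combination hX
    have hlie : ∀ X Y Z : Matrix (Fin n) (Fin n) K,
        a • (X * Y * Z) + b • (X * Z * Y) + c • (Y * X * Z) + d • (Y * Z * X) +
          e • (Z * X * Y) + g • (Z * Y * X) = a • ⁅X, ⁅Y, Z⁆⁆ + c • ⁅Y, ⁅X, Z⁆⁆ := by
      intro X Y Z
      simp only [Ring.lie_def, mul_sub, sub_mul, ← mul_assoc]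
      rw [hg, he, hb, hd]
      module
    by_cases ha : a = 0
    · have hc : c ≠ 0 := fun hc => h (by simp [hg, he, hb, hd, ha, hc])
      refine ⟨Y, X, c⁻¹ • Z, ?_⟩
      rw [hlie]
      simp only [lie_smul, hXYZ, hYXZ, smul_zero, zero_add, smul_inv_smul₀ hc]
    · refine ⟨X, Y, a⁻¹ • Z, ?_⟩
      rw [hlie]
      simp only [lie_smul, hXYZ, hYXZ, smul_zero, add_zero, smul_inv_smul₀ ha]
end
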